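/- arXiv:1210.6460 — 4 statements merged into one kernel-verified Lean document; each statement's English description precedes it below -/
import Mathlib

section
/- Let G be a 2-connected bipartite graph on n ≥ 4 vertices. Then Sz(G) − W(G) ≥ 4n − 8, with equality if and only if G is the 4-cycle C_4. -/
open Finset

variable {V : Type*} [Fintype V] [DecidableEq V]

/-- Number of vertices strictly closer to `u` than to `v`. -/
noncomputable def nCloser (G : SimpleGraph V) (u v : V) : ℕ :=
  (Finset.univ.filter (fun w => G.dist u w < G.dist v w)).card

/-- Number of vertices equidistant from `u` and `v`. -/
noncomputable def nEqual (G : SimpleGraph V) (u v : V) : ℕ :=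
  (Finset.univ.filter (fun w => G.dist u w = G.dist v w)).card

/-- `n_0(e)` for an edge `e`. -/
noncomputable def nZero (G : SimpleGraph V) : Sym2 V → ℕ :=
  Sym2.lift ⟨fun u v => nEqual G u v, by
    intro u v
    unfold nEqual
    exact congrArg Finset.card (Finset.filter_congr fun w _ => eq_comm)⟩

/-- The contribution `n_u(e) * n_v(e)` of an edge `e`. -/
noncomputable def edgeContribution (G : SimpleGraph V) : Sym2 V → ℕ :=
  Sym2.lift ⟨fun u v => nCloser G u v * nCloser G v u, fun u v => Nat.mul_comm _ _⟩

/-- The Szeged index `Sz(G) = ∑_{e = uv ∈ E} n_u(e) n_v(e)`. -/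
noncomputable def szeged (G : SimpleGraph V) [DecidableRel G.Adj] : ℕ :=
  ∑ e ∈ G.edgeFinset, edgeContribution G e

/-- The revised Szeged index `Sz*(G) = ∑_{e=uv∈E} (n_u(e)+n_0(e)/2)(n_v(e)+n_0(e)/2)`. -/
noncomputable def szegedStar (G : SimpleGraph V) [DecidableRel G.Adj] : ℚ :=
  ∑ e ∈ G.edgeFinset,
    Sym2.lift ⟨fun u v =>
      ((nCloser G u v : ℚ) + (nEqual G u v : ℚ) / 2) *
        ((nCloser G v u : ℚ) + (nEqual G u v : ℚ) / 2), by
      intro u v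
      have h : nEqual G u v = nEqual G v u := by
        unfold nEqual
        exact congrArg Finset.card (Finset.filter_congr fun w _ => eq_comm)
      dsimp only; rw [h]; ring⟩ e

/-- The Wiener index `W(G) = ∑_{{x,y} ⊆ V} d(x,y)`. -/
noncomputable def wiener (G : SimpleGraph V) : ℕ :=
  ∑ p ∈ Finset.univ.sym2, Sym2.lift ⟨fun x y => G.dist x y, fun x y => G.dist_comm⟩ p

/-- `μ_{x,y}(e)`: the indicator that `x` and `y` are strictly closer to
opposite endpoints of the edge `e`. -/
noncomputable def mu (G : SimpleGraph V) (x y : V) : Sym2 V → ℕ :=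
  Sym2.lift ⟨fun u v =>
    if (G.dist x u < G.dist x v ∧ G.dist y v < G.dist y u) ∨
        (G.dist x v < G.dist x u ∧ G.dist y u < G.dist y v) then 1 else 0, by
    intro u v
    dsimp only; exact if_congr or_comm rfl rfl⟩

/-- A graph is 2-connected if it has at least 3 vertices and removing any
single vertex leaves it connected. -/
def TwoConnected (G : SimpleGraph V) : Prop :=
  3 ≤ Fintype.card V ∧ ∀ v : V, (G.induce {u : V | u ≠ v}).Connected


lemma sum_pairs_eq_two_mul (f : Sym2 V → ℕ) (hf : ∀ a, f s(a, a) = 0) :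
    ∑ x, ∑ y, f s(x, y) = 2 * ∑ z, f z := by
  rw [← Finset.sum_product' (f := fun x y => f s(x, y)), Finset.mul_sum]
  rw [← Finset.sum_fiberwise (s := (univ ×ˢ univ : Finset (V × V)))
    (g := fun p : V × V => s(p.1, p.2))]
  refine Finset.sum_congr rfl fun z _ => ?_
  induction z using Sym2.ind with
  | _ a b =>
    by_cases hab : a = b
    · subst hab
      rw [hf, mul_zero]
      refine Finset.sum_eq_zero fun p hp => ?_
      rw [(Finset.mem_filter.1 hp).2, hf]
    · have : ((univ ×ˢ univ : Finset (V × V)).filter (fun p => s(p.1, p.2) = s(a, b)))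
          = {(a, b), (b, a)} := by
        ext ⟨p, q⟩
        simp [Sym2.eq_iff]
      rw [this, Finset.sum_pair (by simp [hab])]
      simp only [Sym2.eq_swap (a := b) (b := a)]
      ring

lemma two_wiener (G : SimpleGraph V) : 2 * wiener G = ∑ x, ∑ y, G.dist x y := by
  have h := sum_pairs_eq_two_mul
    (Sym2.lift ⟨fun x y => G.dist x y, fun x y => G.dist_comm⟩) (by intro a; simp)
  unfold wiener
  rw [Finset.sym2_univ, ← h]
  simp

lemma two_szeged (G : SimpleGraph V) [DecidableRel G.Adj] :
    2 * szeged G = ∑ u, ∑ v, if G.Adj u v then nCloser G u v * nCloser G v u else 0 := by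
  have h := sum_pairs_eq_two_mul
    (fun z => if z ∈ G.edgeFinset then edgeContribution G z else 0) (by intro a; simp)
  unfold szeged
  rw [← Finset.sum_filter] at h
  simp only [Finset.filter_mem_eq_inter, Finset.univ_inter] at h
  rw [← h]
  simp [edgeContribution]

/-- Number of oriented edges separating x from y. -/
noncomputable def sepDarts (G : SimpleGraph V) [DecidableRel G.Adj] (x y : V) : Finset (V × V) :=
  univ.filter fun p => G.Adj p.1 p.2 ∧ G.dist p.1 x < G.dist p.2 x ∧ G.dist p.2 y < G.dist p.1 y

lemma two_szeged_eq (G : SimpleGraph V) [DecidableRel G.Adj] :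
    2 * szeged G = ∑ x, ∑ y, (sepDarts G x y).card := by
  rw [two_szeged]
  have h1 : ∀ x y, (sepDarts G x y).card = ∑ u, ∑ v, if G.Adj u v then
      ((if G.dist u x < G.dist v x then 1 else 0) *
        (if G.dist v y < G.dist u y then 1 else 0)) else 0 := by
    intro x y
    rw [sepDarts, Finset.card_filter, ← Finset.univ_product_univ, Finset.sum_product]
    refine Finset.sum_congr rfl fun u _ => Finset.sum_congr rfl fun v _ => ?_
    by_cases a : G.Adj u v <;> by_cases b : G.dist u x < G.dist v x <;>
      by_cases c : G.dist v y < G.dist u y <;> simp [a, b, c]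
  simp only [h1]
  rw [← Finset.sum_product', ← Finset.sum_product']
  simp only [← Finset.sum_product']
  symm
  rw [Finset.sum_product_right]
  refine Finset.sum_congr rfl fun p _ => ?_
  by_cases a : G.Adj p.1 p.2
  · simp only [a, if_true]
    rw [Finset.sum_product' (f := fun x y => ((if G.dist p.1 x < G.dist p.2 x then 1 else 0) *
        (if G.dist p.2 y < G.dist p.1 y then 1 else 0))), ← Finset.sum_mul_sum]
    simp [nCloser]
  · simp [a]

lemma exists_crossing (G : SimpleGraph V) (h2 : TwoConnected G) (S : Set V) (a b c : V)
    (ha : a ∈ S) (hb : b ∉ S) (hac : a ≠ c) (hbc : b ≠ c) :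
    ∃ u v, G.Adj u v ∧ u ∈ S ∧ v ∉ S ∧ u ≠ c ∧ v ≠ c := by
  obtain ⟨w⟩ := (h2.2 c).preconnected ⟨a, hac⟩ ⟨b, hbc⟩
  obtain ⟨d, _, h1, h3⟩ := w.exists_boundary_dart {z | z.1 ∈ S} ha hb
  exact ⟨d.fst.1, d.snd.1, d.adj, h1, h3, d.fst.2, d.snd.2⟩

lemma exists_third (h : 3 ≤ Fintype.card V) (a b : V) : ∃ c, a ≠ c ∧ b ≠ c := by
  by_contra! hc
  have : (univ : Finset V) ⊆ {a, b} := by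
    intro z _
    by_cases h : a = z
    · simp [h]
    · simp [hc z h]
  have h1 := Finset.card_le_card this
  have h3 := Finset.card_le_two (a := a) (b := b)
  rw [Finset.card_univ] at h1
  omega

lemma two_crossing (G : SimpleGraph V) (h2 : TwoConnected G) (S : Set V) (a b : V)
    (ha : a ∈ S) (hb : b ∉ S) :
    ∃ u v u' v', G.Adj u v ∧ u ∈ S ∧ v ∉ S ∧ G.Adj u' v' ∧ u' ∈ S ∧ v' ∉ S ∧
      (u, v) ≠ (u', v') := by
  obtain ⟨c, hac, hbc⟩ := exists_third h2.1 a b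
  obtain ⟨u, v, huv, hu, hv, -, -⟩ := exists_crossing G h2 S a b c ha hb hac hbc
  obtain ⟨w, huw, hvw⟩ := exists_third h2.1 u v
  by_cases hw : w ∈ S
  · obtain ⟨u', v', h, hu', hv', h1, h3⟩ := exists_crossing G h2 S w v u hw hv huw.symm huv.ne'
    exact ⟨u, v, u', v', huv, hu, hv, h, hu', hv', fun e => h1 (Prod.ext_iff.1 e).1.symm⟩
  · obtain ⟨u', v', h, hu', hv', h1, h3⟩ := exists_crossing G h2 S u w v hu hw huv.ne hvw.symm
    exact ⟨u, v, u', v', huv, hu, hv, h, hu', hv', fun e => h3 (Prod.ext_iff.1 e).2.symm⟩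

lemma TwoConnected.conn {G : SimpleGraph V} (h2 : TwoConnected G) : G.Connected := by
  have : Nonempty V := Fintype.card_pos_iff.1 (by have := h2.1; omega)
  refine ⟨fun a b => ?_⟩
  obtain ⟨c, hac, hbc⟩ := exists_third h2.1 a b
  have := (h2.2 c).preconnected ⟨a, hac⟩ ⟨b, hbc⟩
  exact this.map (SimpleGraph.Embedding.induce _).toHom

lemma walk_parity {G : SimpleGraph V} (C : G.Coloring (Fin 2)) {a b : V} (w : G.Walk a b) :
    (C a = C b ↔ w.length % 2 = 0) := by
  induction w with
  | nil => simp
  | cons h p ih =>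
    have := C.valid h
    rw [SimpleGraph.Walk.length_cons]
    omega

lemma dist_parity {G : SimpleGraph V} (hc : G.Connected) (C : G.Coloring (Fin 2)) (a b : V) :
    (C a = C b ↔ G.dist a b % 2 = 0) := by
  obtain ⟨w, hw⟩ := hc.exists_walk_length_eq_dist a b
  rw [← hw]
  exact walk_parity C w

lemma dist_adj {G : SimpleGraph V} (hc : G.Connected) (C : G.Coloring (Fin 2)) {u v : V}
    (h : G.Adj u v) (x : V) : G.dist v x = G.dist u x + 1 ∨ G.dist u x = G.dist v x + 1 := by
  have h1 := dist_parity hc C u x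
  have h3 := dist_parity hc C v x
  have h4 := C.valid h
  have h5 := hc.dist_triangle (u := u) (v := v) (w := x)
  have h6 := hc.dist_triangle (u := v) (v := u) (w := x)
  rw [SimpleGraph.dist_eq_one_iff_adj.2 h] at h5
  rw [SimpleGraph.dist_eq_one_iff_adj.2 h.symm] at h6
  omega

lemma sepDarts_card (G : SimpleGraph V) [DecidableRel G.Adj] (h2 : TwoConnected G)
    (C : G.Coloring (Fin 2)) (x y : V) : 2 * G.dist x y ≤ (sepDarts G x y).card := by
  have hc := h2.conn
  set d := G.dist x y with hd
  let φ : V → ℤ := fun z => (G.dist z x : ℤ) - G.dist z y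
  let T : ℕ → Finset (V × V) := fun k => (sepDarts G x y).filter
    fun p => φ p.1 ≤ -d + 2 * k ∧ -(d : ℤ) + 2 * k < φ p.1 + 2
  have hT : ∀ k ∈ Finset.range d, 2 ≤ (T k).card := by
    intro k hk
    have hk := Finset.mem_range.1 hk
    obtain ⟨u, v, u', v', h, hu, hv, h', hu', hv', hne⟩ :=
      two_crossing G h2 {z | φ z ≤ -d + 2 * k} x y
        (by simp only [Set.mem_setOf_eq, φ, SimpleGraph.dist_self, ← hd]; omega)
        (by
          have : G.dist y x = d := by rw [hd, SimpleGraph.dist_comm]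
          simp only [Set.mem_setOf_eq, φ, SimpleGraph.dist_self, this]; omega)
    have key : ∀ u v, G.Adj u v → φ u ≤ -d + 2 * k → ¬ φ v ≤ -d + 2 * k → (u, v) ∈ T k := by
      intro u v h hu hv
      have h1 := dist_adj hc C h x
      have h3 := dist_adj hc C h y
      simp only [T, sepDarts, Finset.mem_filter, Finset.mem_univ, true_and]
      simp only [φ] at hu hv ⊢
      refine ⟨⟨h, ?_, ?_⟩, ?_, ?_⟩ <;> omega
    have hsub : ({(u, v), (u', v')} : Finset (V × V)) ⊆ T k := by
      intro p hp
      rcases Finset.mem_insert.1 hp with rfl | hp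
      · exact key _ _ h hu hv
      · rw [Finset.mem_singleton.1 hp]; exact key _ _ h' hu' hv'
    have := Finset.card_le_card hsub
    rwa [Finset.card_pair hne] at this
  have hdisj : ((Finset.range d : Finset ℕ) : Set ℕ).PairwiseDisjoint T := by
    intro k _ l _ hkl
    refine Finset.disjoint_left.2 fun p hp hq => ?_
    have hp := (Finset.mem_filter.1 hp).2
    have hq := (Finset.mem_filter.1 hq).2
    omega
  calc 2 * d = ∑ k ∈ Finset.range d, 2 := by simp [mul_comm]
    _ ≤ ∑ k ∈ Finset.range d, (T k).card := Finset.sum_le_sum hT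
    _ = ((Finset.range d).biUnion T).card := (Finset.card_biUnion hdisj).symm
    _ ≤ _ := Finset.card_le_card (Finset.biUnion_subset.2 fun k _ => Finset.filter_subset _ _)

lemma two_wiener_le_szeged (G : SimpleGraph V) [DecidableRel G.Adj] (h2 : TwoConnected G)
    (C : G.Coloring (Fin 2)) : 2 * wiener G ≤ szeged G := by
  have h : 2 * (2 * wiener G) ≤ 2 * szeged G := by
    rw [two_wiener, two_szeged_eq, Finset.mul_sum]
    refine Finset.sum_le_sum fun x _ => ?_
    rw [Finset.mul_sum]
    exact Finset.sum_le_sum fun y _ => sepDarts_card G h2 C x y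
  omega

lemma wiener_lower (G : SimpleGraph V) (hc : G.Connected) (C : G.Coloring (Fin 2)) :
    3 * (Fintype.card V : ℤ) ^ 2 - 4 * Fintype.card V ≤ 4 * wiener G := by
  have h1 : (2 * wiener G : ℤ) = ∑ x, ∑ y, (G.dist x y : ℤ) := by exact_mod_cast two_wiener G
  have h3 : ∀ x y, 1 + (if C x = C y then (1 : ℤ) else 0) - (if x = y then 2 else 0)
      ≤ G.dist x y := by
    intro x y
    by_cases hxy : x = y
    · subst hxy; simp
    · have h4 := dist_parity hc C x y
      have h5 := hc.pos_dist_of_ne hxy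
      simp only [hxy, if_false]
      split_ifs with h
      · have := h4.1 h; omega
      · omega
  have h4 : ∑ x, ∑ y, (1 + (if C x = C y then (1 : ℤ) else 0) - (if x = y then 2 else 0))
      ≤ 2 * wiener G := by
    rw [h1]
    exact Finset.sum_le_sum fun x _ => Finset.sum_le_sum fun y _ => h3 x y
  set n : ℤ := (Fintype.card V : ℤ) with hn
  have h5 : ∑ x, ∑ y, (if C x = C y then (1 : ℤ) else 0)
      = ∑ i : Fin 2, ((univ.filter fun x => C x = i).card : ℤ) ^ 2 := by
    have : ∀ x y, (if C x = C y then (1 : ℤ) else 0)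
        = ∑ i : Fin 2, (if C x = i then 1 else 0) * (if C y = i then 1 else 0) := by
      intro x y
      simp [eq_comm]
    simp only [this]
    have e : ∀ x, ∑ y, ∑ i : Fin 2, (if C x = i then (1 : ℤ) else 0) * (if C y = i then 1 else 0)
        = ∑ i : Fin 2, ∑ y, (if C x = i then (1 : ℤ) else 0) * (if C y = i then 1 else 0) :=
      fun x => Finset.sum_comm
    simp only [e]
    rw [Finset.sum_comm]
    refine Finset.sum_congr rfl fun i _ => ?_
    rw [← Finset.sum_mul_sum, sq]
    simp
  have h6 : (((univ.filter fun x => C x = 0).card : ℤ)) + ((univ.filter fun x => C x = 1).card : ℤ)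
      = n := by
    have := Finset.card_eq_sum_card_fiberwise (f := C) (s := univ) (t := univ)
      (fun x _ => Finset.mem_coe.2 (Finset.mem_univ _))
    rw [Finset.card_univ, Fin.sum_univ_two] at this
    rw [hn, this]; push_cast; rfl
  simp only [Finset.sum_sub_distrib, Finset.sum_add_distrib] at h4
  rw [h5, Fin.sum_univ_two] at h4
  simp only [Finset.sum_const, Finset.card_univ, Finset.sum_ite_eq, Finset.mem_univ, if_true,
    nsmul_eq_mul, ← hn, mul_one] at h4
  set p := ((univ.filter fun x => C x = 0).card : ℤ)
  set q := ((univ.filter fun x => C x = 1).card : ℤ)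
  rw [← h6] at h4 ⊢
  nlinarith [sq_nonneg (p - q)]

lemma two_nbrs (G : SimpleGraph V) (h2 : TwoConnected G) (x : V) :
    ∃ a b, a ≠ b ∧ G.Adj x a ∧ G.Adj x b := by
  obtain ⟨y, hy, -⟩ := exists_third h2.1 x x
  obtain ⟨u, v, u', v', h, hu, hv, h', hu', hv', hne⟩ := two_crossing G h2 {x} x y rfl hy.symm
  rw [Set.mem_singleton_iff] at hu hu'
  subst hu; subst hu'
  exact ⟨v, v', fun e => hne (by rw [e]), h, h'⟩

lemma iso_of_card_four (G : SimpleGraph V) (h2 : TwoConnected G)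
    (C : G.Coloring (Fin 2)) (h4 : Fintype.card V = 4) :
    Nonempty (G ≃g SimpleGraph.cycleGraph 4) := by
  have : Nonempty V := Fintype.card_pos_iff.1 (by omega)
  obtain ⟨x⟩ := this
  obtain ⟨a, b, hab, hxa, hxb⟩ := two_nbrs G h2 x
  obtain ⟨y, hy⟩ : ∃ y, y ∉ ({x, a, b} : Finset V) := by
    by_contra! hcon
    have h1 := Finset.card_le_card (show (univ : Finset V) ⊆ {x, a, b} from fun z _ => hcon z)
    have h3 := Finset.card_le_three (a := x) (b := a) (c := b)
    rw [Finset.card_univ] at h1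
    omega
  simp only [Finset.mem_insert, Finset.mem_singleton, not_or] at hy
  obtain ⟨hyx, hya, hyb⟩ := hy
  have hcov : ∀ z, z = x ∨ z = a ∨ z = y ∨ z = b := by
    have hcard : ({x, a, y, b} : Finset V).card = 4 := by
      rw [Finset.card_insert_of_notMem, Finset.card_insert_of_notMem,
        Finset.card_insert_of_notMem, Finset.card_singleton]
      · simpa using hyb
      · simp [hab, Ne.symm hya]
      · simp [hxa.ne, hxb.ne, Ne.symm hyx]
    have := (Finset.card_eq_iff_eq_univ _).1 (hcard.trans h4.symm)
    intro z
    have hz := Finset.mem_univ z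
    rw [← this] at hz
    simpa using hz
  have ca := C.valid hxa
  have cb := C.valid hxb
  have nab : ¬ G.Adj a b := fun h => by have := C.valid h; omega
  have hay : G.Adj a y := by
    obtain ⟨p, q, hpq, hp, hq⟩ := two_nbrs G h2 a
    rcases hcov p with rfl | rfl | rfl | rfl
    · rcases hcov q with rfl | rfl | rfl | rfl
      · exact absurd rfl hpq
      · exact absurd hq (G.loopless.irrefl _)
      · exact hq
      · exact absurd hq nab
    · exact absurd hp (G.loopless.irrefl _)
    · exact hp
    · exact absurd hp nab
  have hby : G.Adj b y := by
    obtain ⟨p, q, hpq, hp, hq⟩ := two_nbrs G h2 b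
    rcases hcov p with rfl | rfl | rfl | rfl
    · rcases hcov q with rfl | rfl | rfl | rfl
      · exact absurd rfl hpq
      · exact absurd hq.symm nab
      · exact hq
      · exact absurd hq (G.loopless.irrefl _)
    · exact absurd hp.symm nab
    · exact hp
    · exact absurd hp (G.loopless.irrefl _)
  have nxy : ¬ G.Adj x y := fun h => by
    have := C.valid h
    have := C.valid hay
    omega
  have nyx : ¬ G.Adj y x := fun h => nxy h.symm
  have nba : ¬ G.Adj b a := fun h => nab h.symm
  let f : Fin 4 → V := ![x, a, y, b]
  have hsurj : Function.Surjective f := by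
    intro z
    rcases hcov z with rfl | rfl | rfl | rfl
    · exact ⟨0, rfl⟩
    · exact ⟨1, rfl⟩
    · exact ⟨2, rfl⟩
    · exact ⟨3, rfl⟩
  have hbij : Function.Bijective f :=
    (Fintype.bijective_iff_surjective_and_card f).2 ⟨hsurj, by simp [h4]⟩
  refine ⟨RelIso.symm ⟨Equiv.ofBijective f hbij, ?_⟩⟩
  intro i j
  simp only [Equiv.ofBijective_apply]
  fin_cases i <;> fin_cases j <;>
    simp [f, hxa, hxb, hay, hby, hxa.symm, hxb.symm, hay.symm, hby.symm, nxy, nyx, nab, nba] <;>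
    decide

lemma szeged_le_of_iso (G : SimpleGraph V) [DecidableRel G.Adj]
    (e : G ≃g SimpleGraph.cycleGraph 4) : szeged G ≤ 16 := by
  have hV : Fintype.card V = 4 := by simpa using Fintype.card_congr e.toEquiv
  have hE : G.edgeFinset.card = 4 := by
    rw [e.card_edgeFinset_eq]
    decide
  have hb : ∀ z ∈ G.edgeFinset, edgeContribution G z ≤ 4 := by
    intro z _
    induction z using Sym2.ind with
    | _ u v =>
      simp only [edgeContribution, Sym2.lift_mk]
      have : nCloser G u v + nCloser G v u ≤ 4 := by
        unfold nCloser
        rw [← Finset.card_union_of_disjoint, ← hV]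
        · exact Finset.card_le_univ _
        · refine Finset.disjoint_left.2 fun w h1 h3 => ?_
          have h1 := (Finset.mem_filter.1 h1).2
          have h3 := (Finset.mem_filter.1 h3).2
          omega
      nlinarith [sq_nonneg ((nCloser G u v : ℤ) - nCloser G v u), this]
  have := Finset.sum_le_card_nsmul _ _ _ hb
  rw [hE] at this
  simpa [szeged] using this

theorem szeged_sub_wiener_two_connected (G : SimpleGraph V) [DecidableRel G.Adj]
    (h2 : TwoConnected G) (hbip : G.Colorable 2) (hn : 4 ≤ Fintype.card V) :
    4 * (Fintype.card V : ℤ) - 8 ≤ (szeged G : ℤ) - (wiener G : ℤ) ∧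
    ((szeged G : ℤ) - (wiener G : ℤ) = 4 * (Fintype.card V : ℤ) - 8 ↔
      Nonempty (G ≃g SimpleGraph.cycleGraph 4)) := by
  obtain ⟨C⟩ := hbip
  have hS := two_wiener_le_szeged G h2 C
  have hW := wiener_lower G h2.conn C
  have hS' : (2 * wiener G : ℤ) ≤ szeged G := by exact_mod_cast hS
  have hn' : (4 : ℤ) ≤ Fintype.card V := by exact_mod_cast hn
  refine ⟨by nlinarith, fun h => ?_, ?_⟩
  · refine iso_of_card_four G h2 C ?_
    by_contra hne
    have h5 : (5 : ℤ) ≤ Fintype.card V := by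
      have : 5 ≤ Fintype.card V := by omega
      exact_mod_cast this
    nlinarith
  · rintro ⟨e⟩
    have h1 := szeged_le_of_iso G e
    have hV : Fintype.card V = 4 := by simpa using Fintype.card_congr e.toEquiv
    rw [hV] at hW ⊢
    push_cast at hW ⊢
    omega
end

section
/- Let G be a 2-connected bipartite graph on n ≥ 4 vertices whose shortest cycle has length p. Then Sz(G) − W(G) ≥ C(n,2) + (p/2)(p/2 − 1). -/
open Finset

variable {V : Type*} [Fintype V] [DecidableEq V]

namespace SzAux

theorem cross_avoid (G : SimpleGraph V) (h2 : TwoConnected G) (S : Set V) (x y z : V)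
    (hx : x ∈ S) (hy : y ∉ S) (hxz : x ≠ z) (hyz : y ≠ z) :
    ∃ a b, G.Adj a b ∧ a ∈ S ∧ b ∉ S ∧ a ≠ z ∧ b ≠ z := by
  obtain ⟨w⟩ := (h2.2 z).preconnected ⟨x, hxz⟩ ⟨y, hyz⟩
  obtain ⟨d, -, h1, h3⟩ := w.exists_boundary_dart (Subtype.val ⁻¹' S) hx hy
  exact ⟨d.fst, d.snd, d.adj, h1, h3, d.fst.2, d.snd.2⟩

theorem exists_third (h3 : 3 ≤ Fintype.card V) (x y : V) : ∃ z, z ≠ x ∧ z ≠ y := by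
  have : ∃ z, z ∉ ({x, y} : Finset V) := by
    by_contra! h
    have h1 : (Finset.univ : Finset V) ⊆ {x, y} := fun z _ => h z
    have h4 := Finset.card_le_card h1
    have h5 := Finset.card_le_two (a := x) (b := y)
    rw [Finset.card_univ] at h4
    omega
  obtain ⟨z, hz⟩ := this
  exact ⟨z, by simpa using hz⟩

theorem two_cross (G : SimpleGraph V) (h2 : TwoConnected G) (S : Set V) (x y : V)
    (hx : x ∈ S) (hy : y ∉ S) :
    ∃ a b a' b', G.Adj a b ∧ a ∈ S ∧ b ∉ S ∧ G.Adj a' b' ∧ a' ∈ S ∧ b' ∉ S ∧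
      s(a, b) ≠ s(a', b') := by
  obtain ⟨w, hwx, hwy⟩ := exists_third h2.1 x y
  obtain ⟨a, b, hab, ha, hb, -, -⟩ := cross_avoid G h2 S x y w hx hy hwx.symm hwy.symm
  obtain ⟨w', hwa, hwb⟩ := exists_third h2.1 a b
  by_cases hw : w' ∈ S
  · obtain ⟨a', b', h, ha', hb', h1, h3⟩ := cross_avoid G h2 S w' b a hw hb hwa hab.ne'
    refine ⟨a, b, a', b', hab, ha, hb, h, ha', hb', ?_⟩
    intro he
    rw [Sym2.eq_iff] at he
    rcases he with ⟨h, -⟩ | ⟨h, -⟩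
    · exact h1 h.symm
    · exact h3 h.symm
  · obtain ⟨a', b', h, ha', hb', h1, h3⟩ := cross_avoid G h2 S a w' b ha hw hab.ne hwb
    refine ⟨a, b, a', b', hab, ha, hb, h, ha', hb', ?_⟩
    intro he
    rw [Sym2.eq_iff] at he
    rcases he with ⟨-, h⟩ | ⟨-, h⟩
    · exact h3 h.symm
    · exact h1 h.symm

theorem connected (G : SimpleGraph V) (h2 : TwoConnected G) : G.Connected := by
  have : Nonempty V := Fintype.card_pos_iff.mp (by have := h2.1; omega)
  refine ⟨fun x y => ?_⟩
  obtain ⟨w, hwx, hwy⟩ := exists_third h2.1 x y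
  have := (h2.2 w).preconnected ⟨x, hwx.symm⟩ ⟨y, hwy.symm⟩
  exact this.map (SimpleGraph.Embedding.induce _).toHom

theorem dist_step (G : SimpleGraph V) (hG : G.Connected) (hbip : G.Colorable 2) (x a b : V)
    (hab : G.Adj a b) : G.dist x a = G.dist x b + 1 ∨ G.dist x b = G.dist x a + 1 := by
  obtain ⟨c⟩ := hbip
  let c' : G.Coloring Bool := G.recolorOfEquiv finTwoEquiv c
  obtain ⟨p, hp⟩ := hG.exists_walk_length_eq_dist x a
  obtain ⟨q, hq⟩ := hG.exists_walk_length_eq_dist x b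
  have h1 := c'.even_length_iff_congr p
  have h2 := c'.even_length_iff_congr q
  have h3 := c'.valid hab
  have h4 := hG.dist_triangle (u := x) (v := a) (w := b)
  have h5 := hG.dist_triangle (u := x) (v := b) (w := a)
  rw [SimpleGraph.dist_eq_one_iff_adj.mpr hab] at h4
  rw [SimpleGraph.dist_eq_one_iff_adj.mpr hab.symm] at h5
  have h6 : G.dist x a ≠ G.dist x b := by
    intro h
    rw [hp] at h1
    rw [hq, ← h] at h2
    apply h3
    have := h1.symm.trans h2
    revert this
    cases c' x <;> cases c' a <;> cases c' b <;> simp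
  omega

theorem pair_bound (G : SimpleGraph V) [DecidableRel G.Adj] (h2 : TwoConnected G)
    (hbip : G.Colorable 2) (x y : V) :
    2 * G.dist x y ≤ ∑ e ∈ G.edgeFinset, mu G x y e := by
  classical
  have hG := connected G h2
  let f : V → ℤ := fun w => (G.dist x w : ℤ) - G.dist y w
  let P : ℕ → Sym2 V → Prop := fun t e => ∃ a b, e = s(a, b) ∧
    f a ≤ -(G.dist x y : ℤ) + 2 * t ∧ -(G.dist x y : ℤ) + 2 * t < f b
  let E : ℕ → Finset (Sym2 V) := fun t => G.edgeFinset.filter (P t)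
  have hstep : ∀ a b, G.Adj a b → f b ≤ f a + 2 := by
    intro a b hab
    have := dist_step G hG hbip x a b hab
    have := dist_step G hG hbip y a b hab
    simp only [f]; omega
  have hmu : ∀ a b, G.Adj a b → f a < f b → mu G x y s(a, b) = 1 := by
    intro a b hab hlt
    have := dist_step G hG hbip x a b hab
    have := dist_step G hG hbip y a b hab
    simp only [f] at hlt
    simp only [mu, Sym2.lift_mk]
    rw [if_pos]
    left; omega
  have hcard : ∀ t ∈ Finset.range (G.dist x y), 2 ≤ (E t).card := by
    intro t ht
    rw [Finset.mem_range] at ht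
    obtain ⟨a, b, a', b', hab, ha, hb, hab', ha', hb', hne⟩ :=
      two_cross G h2 {w | f w ≤ -(G.dist x y : ℤ) + 2 * t} x y
        (by simp only [Set.mem_setOf_eq, f, SimpleGraph.dist_self, G.dist_comm (u := y)]; omega)
        (by simp only [Set.mem_setOf_eq, f, SimpleGraph.dist_self]; omega)
    simp only [Set.mem_setOf_eq, not_le] at ha hb ha' hb'
    rw [← Finset.card_pair hne]
    apply Finset.card_le_card
    intro e he
    rw [Finset.mem_insert, Finset.mem_singleton] at he
    rcases he with rfl | rfl
    · exact Finset.mem_filter.mpr ⟨by simpa using hab, a, b, rfl, ha, hb⟩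
    · exact Finset.mem_filter.mpr ⟨by simpa using hab', a', b', rfl, ha', hb'⟩
  have hdisj : ∀ t t', t < t' → Disjoint (E t) (E t') := by
    intro t t' htt
    rw [Finset.disjoint_left]
    intro e he he'
    obtain ⟨hadj, a, b, rfl, ha, hb⟩ := Finset.mem_filter.mp he
    obtain ⟨-, a', b', heq, ha', hb'⟩ := Finset.mem_filter.mp he'
    rw [SimpleGraph.mem_edgeFinset, SimpleGraph.mem_edgeSet] at hadj
    have h1 := hstep a b hadj
    rw [Sym2.eq_iff] at heq
    rcases heq with ⟨rfl, rfl⟩ | ⟨rfl, rfl⟩ <;> omega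
  have hpd : ((Finset.range (G.dist x y) : Finset ℕ) : Set ℕ).PairwiseDisjoint E := by
    intro t _ t' _ hne
    rcases lt_or_gt_of_ne hne with h | h
    · exact hdisj _ _ h
    · exact (hdisj _ _ h).symm
  calc 2 * G.dist x y = ∑ t ∈ Finset.range (G.dist x y), 2 := by simp [mul_comm]
    _ ≤ ∑ t ∈ Finset.range (G.dist x y), (E t).card := Finset.sum_le_sum hcard
    _ = ((Finset.range (G.dist x y)).biUnion E).card := (Finset.card_biUnion hpd).symm
    _ = ∑ e ∈ (Finset.range (G.dist x y)).biUnion E, 1 := by simp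
    _ = ∑ e ∈ (Finset.range (G.dist x y)).biUnion E, mu G x y e := by
        refine Finset.sum_congr rfl fun e he => ?_
        obtain ⟨t, -, he⟩ := Finset.mem_biUnion.mp he
        obtain ⟨hadj, a, b, rfl, ha, hb⟩ := Finset.mem_filter.mp he
        rw [SimpleGraph.mem_edgeFinset, SimpleGraph.mem_edgeSet] at hadj
        exact (hmu a b hadj (by omega)).symm
    _ ≤ ∑ e ∈ G.edgeFinset, mu G x y e := by
        apply Finset.sum_le_sum_of_subset
        intro e he
        obtain ⟨t, -, he⟩ := Finset.mem_biUnion.mp he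
        exact (Finset.mem_filter.mp he).1

theorem edge_sum (G : SimpleGraph V) (e : Sym2 V) :
    ∑ x, ∑ y, mu G x y e = 2 * edgeContribution G e := by
  induction e with
  | h u v =>
    have key : ∀ x y, mu G x y s(u, v) =
        (if G.dist u x < G.dist v x then 1 else 0) * (if G.dist v y < G.dist u y then 1 else 0) +
        (if G.dist v x < G.dist u x then 1 else 0) *
          (if G.dist u y < G.dist v y then 1 else 0) := by
      intro x y
      simp only [mu, Sym2.lift_mk, G.dist_comm (u := x), G.dist_comm (u := y)]
      split_ifs <;> first | rfl | omega
    simp only [key, Finset.sum_add_distrib, ← Finset.mul_sum, ← Finset.sum_mul]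
    simp only [edgeContribution, Sym2.lift_mk, nCloser, Finset.card_filter]
    ring

theorem szeged_sum (G : SimpleGraph V) [DecidableRel G.Adj] :
    ∑ x, ∑ y, ∑ e ∈ G.edgeFinset, mu G x y e = 2 * szeged G := by
  rw [szeged, Finset.mul_sum]
  simp only [← edge_sum]
  rw [Finset.sum_comm]
  simp only [Finset.sum_comm (s := Finset.univ) (t := G.edgeFinset)]
  refine Finset.sum_congr rfl fun e _ => Finset.sum_comm

theorem wiener_sum (G : SimpleGraph V) : ∑ x, ∑ y, G.dist x y = 2 * wiener G := by
  rw [wiener, Finset.mul_sum, ← Finset.sum_product', Finset.sym2_univ,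
    ← Finset.sum_fiberwise (Finset.univ ×ˢ Finset.univ) (fun p : V × V => s(p.1, p.2))]
  refine Finset.sum_congr rfl fun z _ => ?_
  induction z with
  | h x y =>
    by_cases hxy : x = y
    · subst hxy
      rw [Sym2.lift_mk]
      simp only [SimpleGraph.dist_self, mul_zero]
      refine Finset.sum_eq_zero fun p hp => ?_
      have := (Finset.mem_filter.mp hp).2
      rw [Sym2.eq_iff] at this
      rcases this with ⟨h1, h3⟩ | ⟨h1, h3⟩ <;> simp [h1, h3]
    · have : (Finset.univ ×ˢ Finset.univ : Finset (V × V)).filter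
          (fun p => s(p.1, p.2) = s(x, y)) = {(x, y), (y, x)} := by
        ext ⟨a, b⟩
        simp [Sym2.eq_iff]
      rw [this, Finset.sum_pair (by simp; tauto), Sym2.lift_mk]
      simp only [G.dist_comm (u := y)]
      ring

theorem szeged_ge (G : SimpleGraph V) [DecidableRel G.Adj] (h2 : TwoConnected G)
    (hbip : G.Colorable 2) : 2 * wiener G ≤ szeged G := by
  have h : ∑ x, ∑ y, 2 * G.dist x y ≤ ∑ x, ∑ y, ∑ e ∈ G.edgeFinset, mu G x y e :=
    Finset.sum_le_sum fun x _ => Finset.sum_le_sum fun y _ => pair_bound G h2 hbip x y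
  rw [szeged_sum] at h
  simp only [← Finset.mul_sum] at h
  rw [wiener_sum] at h
  omega

theorem cycle_of_paths (G : SimpleGraph V) (a b : V) (P Q : G.Walk a b) (hP : P.IsPath)
    (hQ : Q.IsPath) (hne : P.length ≠ Q.length) :
    ∃ (w : V) (c : G.Walk w w), c.IsCycle ∧ c.length ≤ P.length + Q.length := by
  classical
  let H : SimpleGraph V := SimpleGraph.fromEdgeSet {e | e ∈ P.edges ∨ e ∈ Q.edges}
  have hmem : ∀ e, e ∈ H.edgeSet → e ∈ P.edges ∨ e ∈ Q.edges := by
    intro e he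
    simp only [H, SimpleGraph.edgeSet_fromEdgeSet] at he
    exact he.1
  have hle : H ≤ G := by
    intro u v huv
    rcases hmem s(u, v) huv with h | h
    · exact P.adj_of_mem_edges h
    · exact Q.adj_of_mem_edges h
  have hin : ∀ e, e ∈ G.edgeSet → (e ∈ P.edges ∨ e ∈ Q.edges) → e ∈ H.edgeSet := by
    intro e he h
    simp only [H, SimpleGraph.edgeSet_fromEdgeSet]
    exact ⟨h, G.not_isDiag_of_mem_edgeSet he⟩
  have hPt : ∀ e ∈ P.edges, e ∈ H.edgeSet :=
    fun e he => hin e (P.edges_subset_edgeSet he) (Or.inl he)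
  have hQt : ∀ e ∈ Q.edges, e ∈ H.edgeSet :=
    fun e he => hin e (Q.edges_subset_edgeSet he) (Or.inr he)
  have hna : ¬ H.IsAcyclic := by
    intro hac
    have := hac.path_unique ⟨P.transfer H hPt, hP.transfer hPt⟩ ⟨Q.transfer H hQt, hQ.transfer hQt⟩
    have h1 := congrArg (fun p : H.Path a b => p.1.length) this
    simp only [SimpleGraph.Walk.length_transfer] at h1
    exact hne h1
  simp only [SimpleGraph.IsAcyclic, not_forall, not_not] at hna
  obtain ⟨w, c, hc⟩ := hna
  refine ⟨w, c.mapLe hle, hc.mapLe hle, ?_⟩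
  rw [SimpleGraph.Walk.length_map, ← SimpleGraph.Walk.length_edges,
    ← List.toFinset_card_of_nodup hc.edges_nodup, ← SimpleGraph.Walk.length_edges P,
    ← SimpleGraph.Walk.length_edges Q, ← List.length_append]
  refine le_trans (Finset.card_le_card ?_) (List.toFinset_card_le _)
  intro e he
  rw [List.mem_toFinset] at he ⊢
  rw [List.mem_append]
  exact hmem e (c.edges_subset_edgeSet he)

theorem antipodal (G : SimpleGraph V) (hG : G.Connected) (u : V) (c : G.Walk u u)
    (hc : c.IsCycle)
    (hmin : ∀ (w : V) (c' : G.Walk w w), c'.IsCycle → c.length ≤ c'.length)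
    (i : ℕ) (hi : i < c.length / 2) :
    c.length / 2 ≤ G.dist (c.getVert i) (c.getVert (i + c.length / 2)) := by
  by_contra! hlt
  set k := c.length / 2 with hk
  have hv : (c.drop i).getVert k = c.getVert (i + k) := c.drop_getVert i k
  let P : G.Walk (c.getVert i) (c.getVert (i + k)) := ((c.drop i).take k).copy rfl hv
  have hPl : P.length = k := by
    simp only [P, SimpleGraph.Walk.length_copy, SimpleGraph.Walk.take_length,
      SimpleGraph.Walk.drop_length]
    omega
  have hP : P.IsPath := by
    rw [← SimpleGraph.Walk.IsPath.getVert_injOn_iff]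
    intro m hm m' hm' h
    have hm : m ≤ P.length := hm
    have hm' : m' ≤ P.length := hm'
    simp only [P, SimpleGraph.Walk.getVert_copy, SimpleGraph.Walk.take_getVert,
      SimpleGraph.Walk.drop_getVert] at h
    have := hc.getVert_injOn' (by rw [Set.mem_ofPred_eq]; omega) (by rw [Set.mem_ofPred_eq]; omega) h
    omega
  obtain ⟨Q, hQ, hQl⟩ := hG.exists_path_of_dist (c.getVert i) (c.getVert (i + k))
  obtain ⟨w, c', hc', hl⟩ := cycle_of_paths G _ _ P Q hP hQ (by omega)
  have := hmin w c' hc'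
  omega

theorem wiener_ge (G : SimpleGraph V) (hG : G.Connected) (u : V) (c : G.Walk u u)
    (hc : c.IsCycle)
    (hmin : ∀ (w : V) (c' : G.Walk w w), c'.IsCycle → c.length ≤ c'.length) :
    (Fintype.card V).choose 2 + (c.length / 2) * (c.length / 2 - 1) ≤ wiener G := by
  classical
  set k := c.length / 2 with hk
  let g : ℕ → Sym2 V := fun i => s(c.getVert i, c.getVert (i + k))
  let T : Finset (Sym2 V) := (Finset.range k).image g
  have h3 := hc.three_le_length
  have hinj : ∀ i j, i < c.length → j < c.length → c.getVert i = c.getVert j → i = j :=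
    fun i j hi hj h => hc.getVert_injOn' (by rw [Set.mem_ofPred_eq]; omega) (by rw [Set.mem_ofPred_eq]; omega) h
  have hT : T.card = k := by
    rw [Finset.card_image_of_injOn, Finset.card_range]
    intro i hi j hj hij
    rw [Finset.mem_coe, Finset.mem_range] at hi hj
    rcases Sym2.eq_iff.mp hij with ⟨h, -⟩ | ⟨h, -⟩
    · exact hinj _ _ (by omega) (by omega) h
    · have := hinj _ _ (by omega) (by omega) h
      omega
  have hD : (Finset.univ.filter (fun z : Sym2 V => ¬ z.IsDiag)).card =
      (Fintype.card V).choose 2 := by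
    rw [← Sym2.card_subtype_not_diag, Fintype.card_subtype]
  have hsum : ∑ z : Sym2 V, ((if ¬ z.IsDiag then 1 else 0) + (if z ∈ T then (k - 1) else 0)) =
      (Fintype.card V).choose 2 + k * (k - 1) := by
    rw [Finset.sum_add_distrib, ← Finset.card_filter, hD, ← Finset.sum_filter]
    simp [hT]
  rw [← hsum, wiener, Finset.sym2_univ]
  refine Finset.sum_le_sum fun z _ => ?_
  by_cases hz : z ∈ T
  · obtain ⟨i, hi, rfl⟩ := Finset.mem_image.mp hz
    rw [if_pos hz]
    have := antipodal G hG u c hc hmin i (Finset.mem_range.mp hi)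
    rw [← hk] at this
    have h4 : (if ¬ (g i).IsDiag then 1 else 0) ≤ 1 := by split_ifs <;> simp
    simp only [g, Sym2.lift_mk] at h4 ⊢
    omega
  · rw [if_neg hz]
    induction z with
    | h x y =>
      simp only [Sym2.lift_mk, Sym2.mk_isDiag_iff]
      by_cases h : x = y
      · simp [h]
      · have := hG.pos_dist_of_ne h
        simp [h]; omega

end SzAux

theorem szeged_sub_wiener_ge_choose_add (G : SimpleGraph V) [DecidableRel G.Adj]
    (h2 : TwoConnected G) (hbip : G.Colorable 2) (hn : 4 ≤ Fintype.card V)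
    (p : ℕ) (u : V) (c : G.Walk u u) (hc : c.IsCycle) (hp : c.length = p)
    (hmin : ∀ (w : V) (c' : G.Walk w w), c'.IsCycle → c.length ≤ c'.length) :
    ((Fintype.card V).choose 2 : ℤ) + ((p / 2 : ℕ) : ℤ) * (((p / 2 : ℕ) : ℤ) - 1) ≤
      (szeged G : ℤ) - (wiener G : ℤ) := by
  have hG := SzAux.connected G h2
  have h1 := SzAux.szeged_ge G h2 hbip
  have h3 := SzAux.wiener_ge G hG u c hc hmin
  have h4 := hc.three_le_length
  rw [hp] at h3 h4
  have h5 : 1 ≤ p / 2 := by omega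
  have h6 : (((p / 2 - 1 : ℕ)) : ℤ) = ((p / 2 : ℕ) : ℤ) - 1 := by
    rw [Nat.cast_sub h5, Nat.cast_one]
  rw [← h6]
  zify at h1 h3
  push_cast at h1 h3 ⊢
  linarith
end

section
/- The bound Sz(G) − W(G) ≥ 4n − 8 is attained with equality by the graph on n ≥ 4 vertices composed of a 4-cycle C_4 and a tree T on n − 3 vertices sharing a single vertex. -/
open Finset

variable {V : Type*} [Fintype V] [DecidableEq V]

section helpers

theorem aux_sum_adj {U : Type*} [Fintype U] [DecidableEq U] (G : SimpleGraph U)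
    [DecidableRel G.Adj] (f : Sym2 U → ℕ) :
    ∑ z ∈ (univ : Finset (U × U)).filter (fun z => G.Adj z.1 z.2), f s(z.1, z.2)
      = 2 * ∑ e ∈ G.edgeFinset, f e := by
  rw [← Finset.sum_fiberwise_of_maps_to (t := G.edgeFinset) (g := fun z : U × U => s(z.1, z.2)),
    Finset.mul_sum]
  · refine Finset.sum_congr rfl fun e he => ?_
    induction e using Sym2.ind with
    | _ a b =>
      rw [SimpleGraph.mem_edgeFinset, SimpleGraph.mem_edgeSet] at he
      have hne : a ≠ b := he.ne
      have h1 : ((univ : Finset (U × U)).filter (fun z => G.Adj z.1 z.2)).filter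
          (fun z => s(z.1, z.2) = s(a, b)) = {(a, b), (b, a)} := by
        ext ⟨x, y⟩
        simp only [mem_filter, mem_univ, true_and, Sym2.eq_iff, mem_insert, mem_singleton,
          Prod.mk.injEq]
        constructor
        · rintro ⟨_, h⟩; exact h
        · rintro (⟨rfl, rfl⟩ | ⟨rfl, rfl⟩)
          · exact ⟨he, by simp⟩
          · exact ⟨he.symm, by simp⟩
      rw [h1, Finset.sum_pair (by simp [hne]), Sym2.eq_swap (a := b) (b := a)]
      ring
  · rintro ⟨x, y⟩ h
    simpa using h

theorem aux_wiener {U : Type*} [Fintype U] [DecidableEq U] (G : SimpleGraph U) :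
    2 * wiener G = ∑ x, ∑ y, G.dist x y := by
  have h := aux_sum_adj (⊤ : SimpleGraph U)
    (Sym2.lift ⟨fun x y => G.dist x y, fun x y => G.dist_comm⟩)
  have h2 : wiener G = ∑ e ∈ (⊤ : SimpleGraph U).edgeFinset,
      Sym2.lift ⟨fun x y => G.dist x y, fun x y => G.dist_comm⟩ e := by
    unfold wiener
    symm
    apply Finset.sum_subset
    · intro e _; simp
    · intro e _ he
      induction e using Sym2.ind with
      | _ a b =>
        have : a = b := by simpa using he
        subst this
        simp
  rw [h2, ← h, ← Fintype.sum_prod_type' (f := fun x y => G.dist x y)]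
  apply Finset.sum_subset (Finset.filter_subset _ _)
  rintro ⟨a, b⟩ _ he
  have : a = b := by simpa using he
  subst this
  simp

theorem aux_szeged {U : Type*} [Fintype U] [DecidableEq U] (G : SimpleGraph U)
    [DecidableRel G.Adj] :
    2 * szeged G = ∑ z ∈ (univ : Finset (U × U)).filter (fun z => G.Adj z.1 z.2),
      nCloser G z.1 z.2 * nCloser G z.2 z.1 := by
  unfold szeged
  rw [← aux_sum_adj]
  rfl

theorem aux_reach {T : Type*} (H : SimpleGraph T) (hH : H.Connected)
    {a b z : T} (hab : a ≠ b) (h : H.dist z a ≤ H.dist z b) :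
    (H \ SimpleGraph.fromEdgeSet {s(a, b)}).Reachable z a := by
  classical
  obtain ⟨w, hw⟩ := hH.exists_walk_length_eq_dist z a
  have hn : s(a, b) ∉ w.edges := by
    intro hmem
    have hb : b ∈ w.support := w.snd_mem_support_of_mem_edges hmem
    have h1 := w.length_takeUntil_lt_length hb hab.symm
    have h2 := SimpleGraph.dist_le (w.takeUntil b hb)
    omega
  have := w.toDeleteEdge s(a, b) hn
  exact ⟨this⟩

theorem aux_side {T : Type*} (H : SimpleGraph T) (hH : H.IsTree)
    {a b y z : T} (hab : H.Adj a b) (hyz : H.Adj y z) (hne : s(a, b) ≠ s(y, z))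
    (h : H.dist y b < H.dist y a) : H.dist z b < H.dist z a := by
  by_contra hc
  push Not at hc
  have h1 := aux_reach H hH.1 hab.ne hc
  have h2 := aux_reach H hH.1 hab.ne.symm h.le
  rw [Sym2.eq_swap] at h2
  have hbr := (SimpleGraph.isAcyclic_iff_forall_adj_isBridge.1 hH.2) hab
  rw [SimpleGraph.isBridge_iff] at hbr
  have h3 : (H \ SimpleGraph.fromEdgeSet {s(a, b)}).Adj y z := by
    simp only [SimpleGraph.sdiff_adj, SimpleGraph.fromEdgeSet_adj, Set.mem_singleton_iff]
    exact ⟨hyz, fun h => hne h.1.symm⟩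
  exact hbr (h1.symm.trans (h3.symm.reachable.trans h2))

theorem aux_tree {T : Type*} [Fintype T] [DecidableEq T] (H : SimpleGraph T)
    [DecidableRel H.Adj] (hH : H.IsTree) (x : T) (n : ℕ) : ∀ y, H.dist x y = n →
    ((univ : Finset (T × T)).filter (fun z => H.Adj z.1 z.2 ∧ H.dist x z.1 < H.dist x z.2 ∧
      H.dist y z.2 < H.dist y z.1)).card = n := by
  induction n with
  | zero =>
    intro y hy
    have : x = y := by simpa [hH.1.dist_eq_zero_iff] using hy
    subst this
    rw [Finset.card_eq_zero, Finset.filter_eq_empty_iff]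
    rintro ⟨a, b⟩ _ ⟨_, h1, h2⟩
    exact lt_asymm h1 h2
  | succ n ih =>
    intro y hy
    obtain ⟨z, hzy, hz⟩ : ∃ z, H.Adj z y ∧ H.dist x z = n := by
      obtain ⟨w, hw⟩ := hH.1.exists_walk_length_eq_dist y x
      rw [SimpleGraph.dist_comm, hy] at hw
      cases w with
      | nil => simp at hw
      | cons h w' =>
        rename_i v
        refine ⟨v, h.symm, ?_⟩
        have h1 := SimpleGraph.dist_le w'
        have h2 := hH.1.dist_triangle (u := x) (v := v) (w := y)
        have h3 := SimpleGraph.dist_eq_one_iff_adj.2 h.symm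
        rw [SimpleGraph.dist_comm] at h1
        simp at hw
        omega
    have h1 := SimpleGraph.dist_eq_one_iff_adj.2 hzy
    have h2 := SimpleGraph.dist_eq_one_iff_adj.2 hzy.symm
    have key : (univ : Finset (T × T)).filter (fun e => H.Adj e.1 e.2 ∧
        H.dist x e.1 < H.dist x e.2 ∧ H.dist y e.2 < H.dist y e.1) =
        insert (z, y) ((univ : Finset (T × T)).filter (fun e => H.Adj e.1 e.2 ∧
        H.dist x e.1 < H.dist x e.2 ∧ H.dist z e.2 < H.dist z e.1)) := by
      ext ⟨a, b⟩
      simp only [mem_filter, mem_univ, true_and, mem_insert, Prod.mk.injEq]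
      constructor
      · rintro ⟨hab, hx, hyy⟩
        by_cases hne : s(a, b) = s(y, z)
        · rw [Sym2.eq_iff] at hne
          rcases hne with ⟨rfl, rfl⟩ | ⟨rfl, rfl⟩
          · omega
          · simp
        · exact Or.inr ⟨hab, hx, aux_side H hH hab hzy.symm hne hyy⟩
      · rintro (⟨rfl, rfl⟩ | ⟨hab, hx, hyy⟩)
        · refine ⟨hzy, by omega, ?_⟩
          simp [h2]
        · by_cases hne : s(a, b) = s(z, y)
          · rw [Sym2.eq_iff] at hne
            rcases hne with ⟨rfl, rfl⟩ | ⟨rfl, rfl⟩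
            · simp at hyy
            · omega
          · exact ⟨hab, hx, aux_side H hH hab hzy hne hyy⟩
    rw [key, Finset.card_insert_of_notMem, ih z hz]
    simp

/-- Distance on the 4-cycle. -/
def dC (c d : Fin 4) : ℕ := if c = d then 0 else if d = c + 2 then 2 else 1

theorem dC_cases : ∀ c d : Fin 4, (dC c d = 0 ∧ c = d) ∨
    (dC c d = 1 ∧ (SimpleGraph.cycleGraph 4).Adj c d) ∨
    (dC c d = 2 ∧ ∃ e, (SimpleGraph.cycleGraph 4).Adj c e ∧ (SimpleGraph.cycleGraph 4).Adj e d) := by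
  decide

theorem dC_lip : ∀ c d e : Fin 4, (SimpleGraph.cycleGraph 4).Adj d e → dC c e ≤ dC c d + 1 := by
  decide

theorem dC_count : ∀ c d : Fin 4,
    ((univ : Finset (Fin 4 × Fin 4)).filter (fun z => (SimpleGraph.cycleGraph 4).Adj z.1 z.2 ∧
      dC c z.1 < dC c z.2 ∧ dC d z.2 < dC d z.1)).card = 2 * dC c d := by
  decide

end helpers

section core

theorem aux_prod {U : Type*} [Fintype U] (P Q : U → Prop) [DecidablePred P] [DecidablePred Q] :
    ((univ.filter P).card * (univ.filter Q).card) =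
      ∑ x, ∑ y, if P x ∧ Q y then 1 else 0 := by
  rw [Finset.card_filter, Finset.card_filter, Finset.sum_mul_sum]
  refine Finset.sum_congr rfl fun x _ => Finset.sum_congr rfl fun y _ => ?_
  by_cases h1 : P x <;> by_cases h2 : Q y <;> simp [h1, h2]

theorem aux_swap {U A : Type*} [Fintype U] [Fintype A] (R : A → Prop) [DecidablePred R]
    (P Q : A → U → Prop) [∀ z, DecidablePred (P z)] [∀ z, DecidablePred (Q z)] :
    ∑ z ∈ univ.filter R, ((univ.filter (P z)).card * (univ.filter (Q z)).card) =
      ∑ x, ∑ y, (univ.filter (fun z => R z ∧ P z x ∧ Q z y)).card := by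
  simp_rw [aux_prod]
  rw [Finset.sum_comm]
  refine Finset.sum_congr rfl fun x _ => ?_
  rw [Finset.sum_comm]
  refine Finset.sum_congr rfl fun y _ => ?_
  rw [← Finset.card_filter, Finset.filter_filter]

theorem aux_core {U T : Type*} [Fintype U] [DecidableEq U] [Fintype T] [DecidableEq T]
    (G : SimpleGraph U) [DecidableRel G.Adj] (hG : G.Connected)
    (H : SimpleGraph T) (hH : H.IsTree)
    (i : T → U) (j : Fin 4 → U) (q : U → T) (p : U → Fin 4) (r : T) (k : Fin 4)
    (hqi : ∀ a, q (i a) = a) (hpi : ∀ a, p (i a) = k)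
    (hpj : ∀ c, p (j c) = c) (hqj : ∀ c, q (j c) = r) (hr : i r = j k)
    (hadji : ∀ a b, G.Adj (i a) (i b) ↔ H.Adj a b)
    (hadjj : ∀ c d, G.Adj (j c) (j d) ↔ (SimpleGraph.cycleGraph 4).Adj c d)
    (hv : ∀ v, i (q v) = v ∨ j (p v) = v)
    (hedge : ∀ u v, G.Adj u v → (i (q u) = u ∧ i (q v) = v) ∨ (j (p u) = u ∧ j (p v) = v)) :
    2 * szeged G = 2 * wiener G + ∑ x, ∑ y, dC (p x) (p y) := by
  classical
  have hTub : ∀ a b, G.dist (i a) (i b) ≤ H.dist a b := by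
    intro a b
    obtain ⟨w, hw⟩ := hH.1.exists_walk_length_eq_dist a b
    let f : H →g G := ⟨i, fun {a b} h => (hadji a b).2 h⟩
    have := SimpleGraph.dist_le (w.map f)
    rw [SimpleGraph.Walk.length_map, hw] at this
    exact this
  have hCub : ∀ c d, G.dist (j c) (j d) ≤ dC c d := by
    intro c d
    rcases dC_cases c d with ⟨h, h'⟩ | ⟨h, h'⟩ | ⟨h, e, h1, h2⟩
    · subst h'; simp
    · rw [h, SimpleGraph.dist_eq_one_iff_adj.2 ((hadjj c d).2 h')]
    · have a1 := SimpleGraph.dist_eq_one_iff_adj.2 ((hadjj c e).2 h1)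
      have a2 := SimpleGraph.dist_eq_one_iff_adj.2 ((hadjj e d).2 h2)
      have := hG.dist_triangle (u := j c) (v := j e) (w := j d)
      omega
  have hlow : ∀ (x y z : U), ∀ w : G.Walk y z,
      H.dist (q x) (q z) + dC (p x) (p z) ≤ H.dist (q x) (q y) + dC (p x) (p y) + w.length := by
    intro x y z w
    induction w with
    | nil => simp
    | @cons a b c h w ih =>
      rw [SimpleGraph.Walk.length_cons]
      have : H.dist (q x) (q b) + dC (p x) (p b) ≤ H.dist (q x) (q a) + dC (p x) (p a) + 1 := by
        rcases hedge a b h with ⟨h1, h2⟩ | ⟨h1, h2⟩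
        · have e1 : p a = p b := by rw [← h1, ← h2, hpi, hpi]
          have e2 : H.Adj (q a) (q b) := by rw [← hadji, h1, h2]; exact h
          have e3 := SimpleGraph.dist_eq_one_iff_adj.2 e2
          have := hH.1.dist_triangle (u := q x) (v := q a) (w := q b)
          rw [e1]; omega
        · have e1 : q a = q b := by rw [← h1, ← h2, hqj, hqj]
          have e2 : (SimpleGraph.cycleGraph 4).Adj (p a) (p b) := by
            rw [← hadjj, h1, h2]; exact h
          have := dC_lip (p x) _ _ e2
          rw [e1]; omega
      omega
  have dC_self : ∀ c, dC c c = 0 := by decide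
  have hD : ∀ x y, G.dist x y = H.dist (q x) (q y) + dC (p x) (p y) := by
    intro x y
    apply le_antisymm
    · rcases hv x with hx | hx <;> rcases hv y with hy | hy
      · have := hTub (q x) (q y)
        rw [hx, hy] at this; omega
      · have h1 := hTub (q x) r
        have h2 := hCub k (p y)
        have h3 := hG.dist_triangle (u := x) (v := j k) (w := y)
        have e1 : p x = k := by rw [← hx, hpi]
        have e2 : q y = r := by rw [← hy, hqj]
        rw [hx, hr] at h1
        rw [hy] at h2
        rw [e1, e2]; omega
      · have h1 := hTub r (q y)
        have h2 := hCub (p x) k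
        have h3 := hG.dist_triangle (u := x) (v := j k) (w := y)
        have e1 : p y = k := by rw [← hy, hpi]
        have e2 : q x = r := by rw [← hx, hqj]
        rw [hy, hr] at h1
        rw [hx] at h2
        rw [e1, e2]; omega
      · have := hCub (p x) (p y)
        rw [hx, hy] at this; omega
    · obtain ⟨w, hw⟩ := hG.exists_walk_length_eq_dist x y
      have := hlow x x y w
      rw [dC_self, SimpleGraph.dist_self] at this
      omega
  have dC_comm : ∀ c d, dC c d = dC d c := by decide
  have hcli : ∀ a b, nCloser G (i a) (i b) =
      (univ.filter fun x => H.dist (q x) a < H.dist (q x) b).card := by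
    intro a b
    unfold nCloser
    congr 1
    ext x
    simp only [mem_filter, mem_univ, true_and]
    rw [hD, hD, hqi, hqi, hpi, hpi, H.dist_comm (u := a), H.dist_comm (u := b)]
    omega
  have hclj : ∀ c d, nCloser G (j c) (j d) =
      (univ.filter fun x => dC (p x) c < dC (p x) d).card := by
    intro a b
    unfold nCloser
    congr 1
    ext x
    simp only [mem_filter, mem_univ, true_and]
    rw [hD, hD, hqj, hqj, hpj, hpj, dC_comm a, dC_comm b]
    omega
  have hT : ∑ z ∈ ((univ : Finset (U × U)).filter (fun z => G.Adj z.1 z.2)).filter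
        (fun z => i (q z.1) = z.1 ∧ i (q z.2) = z.2), nCloser G z.1 z.2 * nCloser G z.2 z.1
      = ∑ x, ∑ y, H.dist (q x) (q y) := by
    trans ∑ z ∈ (univ : Finset (T × T)).filter (fun z => H.Adj z.1 z.2),
        nCloser G (i z.1) (i z.2) * nCloser G (i z.2) (i z.1)
    · refine Finset.sum_nbij' (fun z => (q z.1, q z.2)) (fun z => (i z.1, i z.2)) ?_ ?_ ?_ ?_ ?_
      · rintro ⟨a, b⟩ h
        simp only [mem_filter, mem_univ, true_and] at h ⊢
        rw [← hadji, h.2.1, h.2.2]; exact h.1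
      · rintro ⟨a, b⟩ h
        simp only [mem_filter, mem_univ, true_and] at h ⊢
        rw [hadji, hqi, hqi]; exact ⟨h, rfl, rfl⟩
      · rintro ⟨a, b⟩ h
        simp only [mem_filter, mem_univ, true_and] at h ⊢
        rw [h.2.1, h.2.2]
      · rintro ⟨a, b⟩ h
        simp only [hqi]
      · rintro ⟨a, b⟩ h
        simp only [mem_filter, mem_univ, true_and] at h ⊢
        rw [h.2.1, h.2.2]
    · simp_rw [hcli]
      rw [aux_swap (fun z : T × T => H.Adj z.1 z.2)
        (fun z x => H.dist (q x) z.1 < H.dist (q x) z.2)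
        (fun z x => H.dist (q x) z.2 < H.dist (q x) z.1)]
      refine Finset.sum_congr rfl fun x _ => Finset.sum_congr rfl fun y _ => ?_
      exact aux_tree H hH (q x) _ (q y) rfl
  have hC : ∑ z ∈ ((univ : Finset (U × U)).filter (fun z => G.Adj z.1 z.2)).filter
        (fun z => ¬ (i (q z.1) = z.1 ∧ i (q z.2) = z.2)), nCloser G z.1 z.2 * nCloser G z.2 z.1
      = ∑ x, ∑ y, 2 * dC (p x) (p y) := by
    trans ∑ z ∈ (univ : Finset (Fin 4 × Fin 4)).filter
        (fun z => (SimpleGraph.cycleGraph 4).Adj z.1 z.2),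
        nCloser G (j z.1) (j z.2) * nCloser G (j z.2) (j z.1)
    · have hh : ∀ u v, G.Adj u v → ¬ (i (q u) = u ∧ i (q v) = v) → j (p u) = u ∧ j (p v) = v :=
        fun u v h h' => (hedge u v h).resolve_left h'
      refine Finset.sum_nbij' (fun z => (p z.1, p z.2)) (fun z => (j z.1, j z.2)) ?_ ?_ ?_ ?_ ?_
      · rintro ⟨a, b⟩ h
        simp only [mem_filter, mem_univ, true_and] at h ⊢
        have h' := hh _ _ h.1 h.2
        rw [← hadjj, h'.1, h'.2]; exact h.1
      · rintro ⟨a, b⟩ h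
        simp only [mem_filter, mem_univ, true_and] at h ⊢
        rw [hadjj, hqj, hqj]
        refine ⟨h, fun ⟨h1, h2⟩ => h.ne ?_⟩
        rw [← hpj a, ← hpj b, ← h1, ← h2]
      · rintro ⟨a, b⟩ h
        simp only [mem_filter, mem_univ, true_and] at h ⊢
        have h' := hh _ _ h.1 h.2
        rw [h'.1, h'.2]
      · rintro ⟨a, b⟩ h
        simp only [hpj]
      · rintro ⟨a, b⟩ h
        simp only [mem_filter, mem_univ, true_and] at h ⊢
        have h' := hh _ _ h.1 h.2
        rw [h'.1, h'.2]
    · simp_rw [hclj]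
      rw [aux_swap (fun z : Fin 4 × Fin 4 => (SimpleGraph.cycleGraph 4).Adj z.1 z.2)
        (fun z x => dC (p x) z.1 < dC (p x) z.2)
        (fun z x => dC (p x) z.2 < dC (p x) z.1)]
      refine Finset.sum_congr rfl fun x _ => Finset.sum_congr rfl fun y _ => ?_
      exact dC_count (p x) (p y)
  rw [aux_szeged, aux_wiener, ← Finset.sum_filter_add_sum_filter_not _
    (fun z => i (q z.1) = z.1 ∧ i (q z.2) = z.2), hT, hC]
  simp_rw [hD]
  simp_rw [two_mul, Finset.sum_add_distrib]
  ring

theorem aux_count {U : Type*} [Fintype U] [DecidableEq U] (p : U → Fin 4) (k : Fin 4)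
    (m : ℕ) (hm : ∀ c, (univ.filter fun x => p x = c).card = if c = k then m else 1) :
    ∑ x, ∑ y, dC (p x) (p y) = 8 * (m + 1) := by
  have h1 : ∀ f : Fin 4 → ℕ, ∑ x, f (p x) = ∑ c, (if c = k then m else 1) * f c := by
    intro f
    rw [← Finset.sum_fiberwise_of_maps_to (t := univ) (g := p) (fun _ _ => mem_univ _)]
    refine Finset.sum_congr rfl fun c _ => ?_
    rw [← hm c, ← smul_eq_mul, ← Finset.sum_const]
    refine Finset.sum_congr rfl fun x hx => ?_
    rw [(Finset.mem_filter.1 hx).2]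
  have h2 : ∀ x, ∑ y, dC (p x) (p y) = ∑ c, (if c = k then m else 1) * dC (p x) c :=
    fun x => h1 (dC (p x))
  simp_rw [h2]
  rw [h1 (fun d => ∑ c, (if c = k then m else 1) * dC d c)]
  fin_cases k <;> simp [Fin.sum_univ_four, dC] <;> ring

end core

theorem szeged_sub_wiener_eq_of_C4_tree (G : SimpleGraph V) [DecidableRel G.Adj]
    (hconn : G.Connected) (hn : 4 ≤ Fintype.card V) (s t : Finset V)
    (hs : s.card = 4) (ht : t.card = Fintype.card V - 3)
    (hunion : s ∪ t = Finset.univ) (hinter : (s ∩ t).card = 1)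
    (hcycle : Nonempty ((G.induce (↑s : Set V)) ≃g SimpleGraph.cycleGraph 4))
    (htree : (G.induce (↑t : Set V)).IsTree)
    (hedges : ∀ e ∈ G.edgeSet, (∀ v ∈ e, v ∈ s) ∨ (∀ v ∈ e, v ∈ t)) :
    (szeged G : ℤ) - (wiener G : ℤ) = 4 * (Fintype.card V : ℤ) - 8 := by
  classical
  obtain ⟨φ⟩ := hcycle
  obtain ⟨ρ, hρ⟩ := Finset.card_eq_one.1 hinter
  have hρst : ρ ∈ s ∧ ρ ∈ t := by
    have : ρ ∈ s ∩ t := by rw [hρ]; simp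
    simpa using this
  have huniq : ∀ v, v ∈ s → v ∈ t → v = ρ := by
    intro v h1 h2
    have : v ∈ s ∩ t := by simp [h1, h2]
    rw [hρ] at this; simpa using this
  have hst : ∀ v, v ∈ s ∨ v ∈ t := by
    intro v
    have : v ∈ s ∪ t := by rw [hunion]; simp
    simpa using this
  let i : (↑t : Set V) → V := fun a => a.1
  let j : Fin 4 → V := fun c => (φ.symm c).1
  let q : V → (↑t : Set V) := fun v => if h : v ∈ t then ⟨v, h⟩ else ⟨ρ, hρst.2⟩
  let p : V → Fin 4 := fun v => if h : v ∈ s then φ ⟨v, h⟩ else φ ⟨ρ, hρst.1⟩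
  let r : (↑t : Set V) := ⟨ρ, hρst.2⟩
  let k : Fin 4 := φ ⟨ρ, hρst.1⟩
  have hjs : ∀ c, j c ∈ s := fun c => (φ.symm c).2
  have hit : ∀ a, i a ∈ t := fun a => a.2
  have hpj : ∀ c, p (j c) = c := by
    intro c
    simp only [p, dif_pos (hjs c)]
    exact φ.apply_symm_apply c
  have hqi : ∀ a, q (i a) = a := by
    intro a
    simp only [q, dif_pos (hit a)]
    rfl
  have hiq : ∀ v ∈ t, i (q v) = v := by
    intro v h
    simp only [q, dif_pos h]
    rfl
  have hjp : ∀ v ∈ s, j (p v) = v := by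
    intro v h
    simp only [p, dif_pos h, j]
    rw [φ.symm_apply_apply]
  have hpt : ∀ v ∈ t, p v = k := by
    intro v h
    by_cases h' : v ∈ s
    · have := huniq v h' h
      subst this
      simp only [p, dif_pos h']
      rfl
    · simp only [p, dif_neg h']
      rfl
  have hqs : ∀ v ∈ s, q v = r := by
    intro v h
    by_cases h' : v ∈ t
    · have := huniq v h h'
      subst this
      simp only [q, dif_pos h']
      rfl
    · simp only [q, dif_neg h']
      rfl
  have hr : i r = j k := by
    simp only [i, j, r, k]
    rw [φ.symm_apply_apply]
  have core := aux_core G hconn (G.induce (↑t : Set V)) htree i j q p r k hqi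
    (fun a => hpt _ (hit a)) hpj (fun c => hqs _ (hjs c)) hr
    (fun a b => Iff.rfl)
    (fun c d => by
      rw [← φ.symm.map_adj_iff]; rfl)
    (fun v => (hst v).symm.imp (hiq v) (hjp v))
    (fun u v h => by
      rcases hedges s(u, v) h with h' | h'
      · exact Or.inr ⟨hjp _ (h' u (by simp)), hjp _ (h' v (by simp))⟩
      · exact Or.inl ⟨hiq _ (h' u (by simp)), hiq _ (h' v (by simp))⟩)
  have cnt := aux_count p k (Fintype.card V - 3) (by
    intro c
    split_ifs with hc
    · subst hc
      rw [← ht]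
      congr 1
      ext v
      simp only [mem_filter, mem_univ, true_and]
      refine ⟨fun h => ?_, hpt v⟩
      rcases hst v with h' | h'
      · have := hjp v h'
        rw [h, ← hr] at this
        rw [← this]
        exact hit r
      · exact h'
    · rw [Finset.card_eq_one]
      refine ⟨j c, ?_⟩
      ext v
      simp only [mem_filter, mem_univ, true_and, mem_singleton]
      constructor
      · intro h
        rcases hst v with h' | h'
        · rw [← h, hjp v h']
        · exact absurd (h.symm.trans (hpt v h')) hc
      · rintro rfl
        exact hpj c)
  rw [cnt] at core
  omega
end

section
/- Let G be a connected bipartite graph with n ≥ 4 vertices and m ≥ n edges. Then the revised Szeged index satisfies Sz*(G) − W(G) ≥ 4n − 8. -/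
open Finset

variable {V : Type*} [Fintype V] [DecidableEq V]

section helpers

theorem sw_step (G : SimpleGraph V) (hconn : G.Connected) (hbip : G.Colorable 2) (x : V) {u v : V}
    (h : G.Adj u v) : G.dist x v = G.dist x u + 1 ∨ G.dist x u = G.dist x v + 1 := by
  have hne : G.dist x u ≠ G.dist x v := by
    intro he
    obtain ⟨C⟩ := hbip
    let c : G.Coloring Bool := (SimpleGraph.recolorOfEquiv G finTwoEquiv) C
    obtain ⟨p, hp⟩ := hconn.exists_walk_length_eq_dist x u
    obtain ⟨q, hq⟩ := hconn.exists_walk_length_eq_dist x v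
    have h1 := c.even_length_iff_congr p
    have h2 := c.even_length_iff_congr q
    rw [hp] at h1
    rw [hq, ← he, h1] at h2
    have h3 := c.valid h
    revert h2 h3
    cases c x <;> cases c u <;> cases c v <;> simp
  have h1 := hconn.dist_triangle (u := x) (v := u) (w := v)
  have h2 := hconn.dist_triangle (u := x) (v := v) (w := u)
  rw [SimpleGraph.dist_eq_one_iff_adj.mpr h] at h1
  rw [SimpleGraph.dist_eq_one_iff_adj.mpr h.symm] at h2
  omega

theorem sw_pred (G : SimpleGraph V) (hconn : G.Connected) {x y : V}
    (h : x ≠ y) : ∃ z, G.Adj z y ∧ G.dist x y = G.dist x z + 1 := by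
  obtain ⟨p, hp⟩ := hconn.exists_walk_length_eq_dist y x
  cases p with
  | nil => exact absurd rfl h
  | @cons _ z _ hadj q =>
    refine ⟨z, hadj.symm, ?_⟩
    have h1 := SimpleGraph.dist_le q
    have h2 := hconn.dist_triangle (u := y) (v := z) (w := x)
    rw [SimpleGraph.dist_eq_one_iff_adj.mpr hadj] at h2
    rw [SimpleGraph.Walk.length_cons] at hp
    rw [G.dist_comm (u := x) (v := y), G.dist_comm (u := x) (v := z)]
    omega

open Classical in
/-- Darts separating `x` from `y`. -/
noncomputable def swSep (G : SimpleGraph V) (x y : V) : Finset (V × V) :=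
  Finset.univ.filter (fun p => G.Adj p.1 p.2 ∧ G.dist x p.1 < G.dist x p.2 ∧
    G.dist y p.2 < G.dist y p.1)

open Classical in
/-- Darts lying on a geodesic from `x` to `y`. -/
noncomputable def swInt (G : SimpleGraph V) (x y : V) : Finset (V × V) :=
  Finset.univ.filter (fun p => G.Adj p.1 p.2 ∧ G.dist x p.1 + 1 + G.dist p.2 y = G.dist x y)

/-- The excess. -/
noncomputable def swEx (G : SimpleGraph V) (x y : V) : ℤ :=
  ((swSep G x y).card : ℤ) - G.dist x y

theorem sw_int_sub (G : SimpleGraph V) (hconn : G.Connected) (x y : V) :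
    swInt G x y ⊆ swSep G x y := by
  rintro ⟨u, v⟩ h
  simp only [swInt, swSep, mem_filter, mem_univ, true_and] at h ⊢
  obtain ⟨hadj, h⟩ := h
  have h1 := hconn.dist_triangle (u := x) (v := v) (w := y)
  have h2 := hconn.dist_triangle (u := x) (v := u) (w := y)
  rw [G.dist_comm (u := y), G.dist_comm (u := y)]
  exact ⟨hadj, by omega, by omega⟩

theorem sw_int_insert (G : SimpleGraph V) (hconn : G.Connected) {x y z : V}
    (hz : G.Adj z y) (hd : G.dist x y = G.dist x z + 1) :
    insert (z, y) (swInt G x z) ⊆ swInt G x y := by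
  rintro ⟨u, v⟩ h
  simp only [swInt, mem_insert, mem_filter, mem_univ, true_and, Prod.mk.injEq] at h ⊢
  rcases h with ⟨rfl, rfl⟩ | ⟨hadj, h⟩
  · simp [hz, hd]
  · refine ⟨hadj, ?_⟩
    have h1 := hconn.dist_triangle (u := v) (v := z) (w := y)
    rw [SimpleGraph.dist_eq_one_iff_adj.mpr hz] at h1
    have h2 := hconn.dist_triangle (u := x) (v := v) (w := y)
    have h3 := hconn.dist_triangle (u := x) (v := u) (w := v)
    rw [SimpleGraph.dist_eq_one_iff_adj.mpr hadj] at h3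
    omega

theorem sw_int_head (G : SimpleGraph V) (hconn : G.Connected) {x z u v : V}
    (h : (u, v) ∈ swInt G x z) (hd : G.dist x z ≤ G.dist x v) : v = z := by
  simp only [swInt, mem_filter, mem_univ, true_and] at h
  have h3 := hconn.dist_triangle (u := x) (v := u) (w := v)
  rw [SimpleGraph.dist_eq_one_iff_adj.mpr h.1] at h3
  exact hconn.dist_eq_zero_iff.mp (by omega)

theorem sw_int_card (G : SimpleGraph V) (hconn : G.Connected) (x : V) :
    ∀ (n : ℕ) (y : V), G.dist x y = n → n ≤ (swInt G x y).card := by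
  intro n
  induction n with
  | zero => intros; omega
  | succ n ih =>
    intro y hy
    have hne : x ≠ y := by
      rintro rfl
      simp at hy
    obtain ⟨z, hz, hd⟩ := sw_pred G hconn hne
    have h1 := Finset.card_le_card (sw_int_insert G hconn hz hd)
    rw [Finset.card_insert_of_notMem] at h1
    · have := ih z (by omega)
      omega
    · intro hm
      exact hz.ne (sw_int_head G hconn hm (by omega)).symm

theorem sw_ex_of_extra (G : SimpleGraph V) (hconn : G.Connected) (x y : V)
    (F : Finset (V × V)) (hF : F ⊆ swSep G x y) (hF2 : ∀ p ∈ F, p ∉ swInt G x y) :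
    (F.card : ℤ) ≤ swEx G x y := by
  have h1 := sw_int_card G hconn x _ y rfl
  have h2 := Finset.card_le_card (Finset.union_subset (sw_int_sub G hconn x y) hF)
  rw [Finset.card_union_of_disjoint] at h2
  · unfold swEx
    omega
  · rw [Finset.disjoint_right]
    exact hF2

theorem sw_ex_nonneg (G : SimpleGraph V) (hconn : G.Connected) (x y : V) :
    0 ≤ swEx G x y := by
  have := sw_ex_of_extra G hconn x y ∅ (by simp) (by simp)
  simpa using this

theorem sw_ex_two (G : SimpleGraph V) (hconn : G.Connected) {x y a b : V}
    (hab : a ≠ b) (ha : G.Adj a y) (hb : G.Adj b y) (hda : G.dist x y = G.dist x a + 1)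
    (hdb : G.dist x y = G.dist x b + 1) : 2 ≤ swEx G x y := by
  have hne : x ≠ b := by
    rintro rfl
    rw [SimpleGraph.dist_self] at hdb
    exact hab ((hconn.dist_eq_zero_iff (u := x) (v := a)).mp (by omega)).symm
  obtain ⟨w, hw, hdw⟩ := sw_pred G hconn hne
  have h1 := sw_int_insert G hconn ha hda
  have h2 := sw_int_insert G hconn hb hdb
  have h3 := sw_int_insert G hconn hw hdw
  have hsub : insert (w, b) (insert (b, y) (insert (a, y) (swInt G x a))) ⊆ swInt G x y := by
    intro p hp
    rw [mem_insert, mem_insert] at hp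
    rcases hp with rfl | rfl | hp
    · exact h2 (mem_insert_of_mem (h3 (mem_insert_self _ _)))
    · exact h2 (mem_insert_self _ _)
    · exact h1 hp
  have hc := Finset.card_le_card (hsub.trans (sw_int_sub G hconn x y))
  have n1 : (a, y) ∉ swInt G x a := fun hm =>
    ha.ne (sw_int_head G hconn hm (by omega)).symm
  have n2 : (b, y) ∉ insert (a, y) (swInt G x a) := by
    rw [mem_insert]
    rintro (hm | hm)
    · exact hab (Prod.mk.inj hm).1.symm
    · exact ha.ne (sw_int_head G hconn hm (by omega)).symm
  have n3 : (w, b) ∉ insert (b, y) (insert (a, y) (swInt G x a)) := by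
    rw [mem_insert, mem_insert]
    rintro (hm | hm | hm)
    · exact hb.ne (Prod.mk.inj hm).2
    · exact hb.ne (Prod.mk.inj hm).2
    · exact hab (sw_int_head G hconn hm (by omega)).symm
  rw [card_insert_of_notMem n3, card_insert_of_notMem n2, card_insert_of_notMem n1] at hc
  have := sw_int_card G hconn x _ a rfl
  unfold swEx
  omega

theorem sw_ex_comm (G : SimpleGraph V) (x y : V) : swEx G x y = swEx G y x := by
  unfold swEx
  rw [G.dist_comm (u := x)]
  congr 2
  apply Finset.card_bij (fun p _ => (p.2, p.1))
  · rintro ⟨u, v⟩ h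
    simp only [swSep, mem_filter, mem_univ, true_and] at h ⊢
    exact ⟨h.1.symm, h.2.2, h.2.1⟩
  · rintro ⟨u, v⟩ _ ⟨u', v'⟩ _ h
    simp only [Prod.mk.injEq] at h ⊢
    exact h.symm
  · rintro ⟨u, v⟩ h
    refine ⟨(v, u), ?_, rfl⟩
    simp only [swSep, mem_filter, mem_univ, true_and] at h ⊢
    exact ⟨h.1.symm, h.2.2, h.2.1⟩

/-- An isometric cycle of length `2k`. -/
structure SwCyc (G : SimpleGraph V) (c : ℤ → V) (k : ℕ) : Prop where
  two : 2 ≤ k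
  adj : ∀ i, G.Adj (c i) (c (i + 1))
  per : ∀ i, c (i + 2 * k) = c i
  iso : ∀ (t : ℕ), t ≤ k → ∀ i, G.dist (c i) (c (i + t)) = t

theorem SwCyc.shift {G : SimpleGraph V} {c : ℤ → V} {k : ℕ} (h : SwCyc G c k) (s : ℤ) :
    SwCyc G (fun i => c (s + i)) k where
  two := h.two
  adj i := by rw [← add_assoc]; exact h.adj _
  per i := by rw [← add_assoc]; exact h.per _
  iso t ht i := by rw [← add_assoc]; exact h.iso t ht _

theorem SwCyc.neg {G : SimpleGraph V} {c : ℤ → V} {k : ℕ} (h : SwCyc G c k) :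
    SwCyc G (fun i => c (-i)) k where
  two := h.two
  adj i := by
    have := (h.adj (-(i+1))).symm
    rwa [show -(i+1)+1 = -i by ring] at this
  per i := by
    have := h.per (-(i + 2 * k))
    rwa [show -(i + 2 * k) + 2 * (k:ℤ) = -i by ring, eq_comm] at this
  iso t ht i := by
    have := h.iso t ht (-(i + t))
    rwa [show -(i + t) + (t:ℤ) = -i by ring, G.dist_comm] at this

theorem SwCyc.dist_sub {G : SimpleGraph V} {c : ℤ → V} {k : ℕ} (h : SwCyc G c k) (i j : ℤ)
    (h1 : i ≤ j) (h2 : j ≤ i + k) : (G.dist (c i) (c j) : ℤ) = j - i := by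
  have := h.iso (j - i).toNat (by omega) i
  rw [show i + ((j - i).toNat : ℤ) = j by omega] at this
  omega

theorem SwCyc.inj {G : SimpleGraph V} {c : ℤ → V} {k : ℕ} (h : SwCyc G c k) (i j : ℤ)
    (h1 : i < j) (h2 : j < i + 2 * k) : c i ≠ c j := by
  intro he
  rcases le_or_gt j (i + k) with h3 | h3
  · have := h.dist_sub i j h1.le h3
    rw [he, SimpleGraph.dist_self] at this
    push_cast at this
    omega
  · have := h.dist_sub j (i + 2 * k) h2.le (by omega)
    rw [h.per, he, SimpleGraph.dist_self] at this
    push_cast at this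
    omega

/-- gated excess bound -/
theorem SwCyc.ex_gated {G : SimpleGraph V} (hconn : G.Connected) {c : ℤ → V} {k : ℕ}
    (h : SwCyc G c k) (x : V)
    (a : ℤ) (hg : ∀ t : ℤ, 0 ≤ t → t ≤ k → (G.dist x (c t) : ℤ) = a + t)
    (hg' : ∀ t : ℤ, 0 ≤ t → t ≤ k → (G.dist x (c (-t)) : ℤ) = a + t)
    (t : ℕ) (ht : t < k) : (t : ℤ) ≤ swEx G x (c t) := by
  have hgk : ∀ i : ℤ, 0 ≤ i → i ≤ k → (G.dist x (c (k + i)) : ℤ) = a + k - i := by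
    intro i h0 h1
    have := hg' (k - i) (by omega) (by omega)
    rw [← h.per, show -((k:ℤ) - i) + 2 * k = k + i by ring] at this
    omega
  let F : Finset (V × V) := (Finset.range t).image (fun i : ℕ => (c (k + i + 1), c (k + i)))
  have hF : F.card = t := by
    rw [Finset.card_image_of_injOn, Finset.card_range]
    intro i hi j hj hij
    simp only [Prod.mk.injEq, Finset.coe_range, Set.mem_Iio] at hij hi hj
    have h1 := hgk i (by omega) (by omega)
    have h2 := hgk j (by omega) (by omega)
    rw [hij.2] at h1
    omega
  have key : ∀ i : ℕ, i < t → (G.dist x (c (k + i)) : ℤ) = a + k - i ∧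
      (G.dist x (c (k + i + 1)) : ℤ) = a + k - i - 1 ∧
      (G.dist (c t) (c (k + i)) : ℤ) = k + i - t ∧
      (G.dist (c t) (c (k + i + 1)) : ℤ) = k + i + 1 - t := by
    intro i hi
    refine ⟨hgk _ (by omega) (by omega), ?_, h.dist_sub _ _ (by omega) (by omega),
      h.dist_sub _ _ (by omega) (by omega)⟩
    have := hgk (i + 1) (by omega) (by omega)
    rw [← add_assoc] at this
    omega
  have := sw_ex_of_extra G hconn x (c t) F ?_ ?_
  · rwa [hF] at this
  · intro p hp
    obtain ⟨i, hi, rfl⟩ := Finset.mem_image.mp hp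
    obtain ⟨k1, k2, k3, k4⟩ := key i (Finset.mem_range.mp hi)
    simp only [swSep, mem_filter, mem_univ, true_and]
    exact ⟨(h.adj _).symm, by omega, by omega⟩
  · intro p hp
    obtain ⟨i, hi, rfl⟩ := Finset.mem_image.mp hp
    obtain ⟨k1, k2, k3, k4⟩ := key i (Finset.mem_range.mp hi)
    simp only [swInt, mem_filter, mem_univ, true_and, not_and]
    intro _
    rw [G.dist_comm (u := c (k + i))]
    have := hg t (by omega) (by omega)
    omega

theorem SwCyc.sum_gated {G : SimpleGraph V} (hconn : G.Connected) {c : ℤ → V} {k : ℕ}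
    (h : SwCyc G c k) (x : V)
    (a : ℤ) (hg : ∀ t : ℤ, 0 ≤ t → t ≤ k → (G.dist x (c t) : ℤ) = a + t)
    (hg' : ∀ t : ℤ, 0 ≤ t → t ≤ k → (G.dist x (c (-t)) : ℤ) = a + t) :
    (k : ℤ) * (k - 1) + 2 ≤ ∑ j ∈ Finset.range (2 * k), swEx G x (c j) := by
  have hk := h.two
  have e1 := h.ex_gated hconn x a hg hg'
  have e2 := h.neg.ex_gated hconn x a hg' (by simpa using hg)
  have e3 : 2 ≤ swEx G x (c k) := by
    have hA := h.adj (k - 1)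
    have hB := (h.adj k).symm
    have hn := h.inj (k - 1) (k + 1) (by omega) (by omega)
    rw [sub_add_cancel] at hA
    have d0 := hg k (by omega) (by omega)
    have d1 := hg (k - 1) (by omega) (by omega)
    have d2 := hg' (k - 1) (by omega) (by omega)
    rw [← h.per, show -((k:ℤ) - 1) + 2 * k = k + 1 by ring] at d2
    exact sw_ex_two G hconn hn hA hB (by omega) (by omega)
  rw [two_mul, Finset.sum_range_add, ← Finset.sum_add_distrib]
  obtain ⟨m, rfl⟩ : ∃ m, k = m + 1 := ⟨k - 1, by omega⟩
  rw [Finset.sum_range_succ']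
  have hs : ∑ i ∈ Finset.range m, ((m + 1 : ℕ) : ℤ) ≤
      ∑ i ∈ Finset.range m, (swEx G x (c ((i + 1 : ℕ) : ℤ)) +
        swEx G x (c ((m + 1 + (i + 1) : ℕ) : ℤ))) := by
    apply Finset.sum_le_sum
    intro i hi
    have hi := Finset.mem_range.mp hi
    have f1 := e1 (i + 1) (by omega)
    have f2 := e2 (m - i) (by omega)
    have : c ((m + 1 + (i + 1) : ℕ) : ℤ) = c (-((m - i : ℕ) : ℤ)) := by
      rw [← h.per (-((m - i : ℕ) : ℤ))]
      congr 1
      omega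
    rw [this]
    omega
  rw [Finset.sum_const, Finset.card_range, nsmul_eq_mul] at hs
  have h0 := sw_ex_nonneg G hconn x (c ((0 : ℕ) : ℤ))
  rw [add_zero]
  push_cast at hs h0 e3 ⊢
  linarith

/-- local maximum lemma -/
theorem sw_locmax (g : ℕ → ℕ) (hs : ∀ i, g (i + 1) = g i + 1 ∨ g i = g (i + 1) + 1)
    (h0 : g 0 ≤ g 1) : ∀ k, g k = g 0 + k ∨ ∃ t, 0 < t ∧ t < k ∧ g t = g (t - 1) + 1 ∧
      g t = g (t + 1) + 1 := by
  intro k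
  induction k with
  | zero => left; rfl
  | succ k ih =>
    rcases ih with ih | ⟨t, h1, h2, h3⟩
    · rcases hs k with h | h
      · left; omega
      · right
        have hk : k ≠ 0 := by
          rintro rfl
          simp at h
          omega
        refine ⟨k, by omega, by omega, ?_, h⟩
        rcases hs (k - 1) with h' | h'
        · rwa [Nat.sub_add_cancel (by omega)] at h'
        · rw [Nat.sub_add_cancel (by omega)] at h'
          have : ∀ j, g j ≤ g 0 + j := by
            intro j
            induction j with
            | zero => simp
            | succ j ihj => have := hs j; omega
          have := this (k - 1)
          omega
    · exact Or.inr ⟨t, h1, by omega, h3⟩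

theorem SwCyc.sum_out {G : SimpleGraph V} (hconn : G.Connected) (hbip : G.Colorable 2)
    {c : ℤ → V} {k : ℕ}
    (h : SwCyc G c k) (x : V) (hmin : ∀ i, G.dist x (c 0) ≤ G.dist x (c i)) :
    4 ≤ ∑ j ∈ Finset.range (2 * k), swEx G x (c j) := by
  have hk := h.two
  by_cases hK : G.dist x (c k) = G.dist x (c 0) + k
  · have hK' : G.dist x (c (-k)) = G.dist x (c 0) + k := by
      rw [← h.per, show -(k:ℤ) + 2 * k = k by ring, hK]
    have := h.sum_gated hconn x (G.dist x (c 0)) ?_ ?_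
    · nlinarith
    · intro t h0 ht
      have h1 := hconn.dist_triangle (u := x) (v := c 0) (w := c t)
      have h2 := hconn.dist_triangle (u := x) (v := c t) (w := c k)
      have h3 := h.dist_sub 0 t h0 (by omega)
      have h4 := h.dist_sub t k ht (by omega)
      omega
    · intro t h0 ht
      have h1 := hconn.dist_triangle (u := x) (v := c 0) (w := c (-t))
      have h2 := hconn.dist_triangle (u := x) (v := c (-t)) (w := c (-k))
      have h3 := h.dist_sub (-t) 0 (by omega) (by omega)
      have h4 := h.dist_sub (-k) (-t) (by omega) (by omega)
      rw [G.dist_comm] at h3 h4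
      omega
  · have aux : ∀ c : ℤ → V, SwCyc G c k → (∀ i, G.dist x (c 0) ≤ G.dist x (c i)) →
        G.dist x (c k) ≠ G.dist x (c 0) + k → ∃ t : ℕ, 0 < t ∧ t < k ∧ 2 ≤ swEx G x (c t) := by
      intro c h hmin hK
      have := sw_locmax (fun i => G.dist x (c i)) (fun i => by
        have := sw_step G hconn hbip x (h.adj i)
        push_cast
        exact this) (by simpa using hmin 1) k
      rcases this with h1 | ⟨t, h1, h2, h3, h4⟩
      · exact absurd (by simpa using h1) hK
      · refine ⟨t, h1, h2, ?_⟩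
        have hA := h.adj (t - 1)
        have hB := (h.adj t).symm
        have hn := h.inj (t - 1) (t + 1) (by omega) (by omega)
        rw [sub_add_cancel] at hA
        push_cast [Nat.cast_sub h1] at h3 h4
        exact sw_ex_two G hconn hn hA hB h3 h4
    obtain ⟨t, t0, t1, t2⟩ := aux c h hmin hK
    obtain ⟨s, s0, s1, s2⟩ := aux _ h.neg (by simpa using fun i => hmin (-i)) (by
      show G.dist x (c (-k)) ≠ G.dist x (c (-0)) + k
      rw [← h.per, show -(k:ℤ) + 2 * k = k by ring, neg_zero]
      exact hK)
    have hsub : ({t, 2 * k - s} : Finset ℕ) ⊆ Finset.range (2 * k) := by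
      intro i hi
      simp only [Finset.mem_insert, Finset.mem_singleton] at hi
      rw [Finset.mem_range]
      omega
    have := Finset.sum_le_sum_of_subset_of_nonneg (f := fun j : ℕ => swEx G x (c j)) hsub
      (fun i _ _ => sw_ex_nonneg G hconn _ _)
    rw [Finset.sum_pair (by omega)] at this
    have e : c ((2 * k - s : ℕ) : ℤ) = c (-(s : ℤ)) := by
      rw [← h.per (-(s : ℤ))]
      congr 1
      omega
    rw [e] at this
    linarith

theorem SwCyc.sum_in {G : SimpleGraph V} (hconn : G.Connected)
    {c : ℤ → V} {k : ℕ} (h : SwCyc G c k) :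
    (k : ℤ) * (k - 1) + 2 ≤ ∑ j ∈ Finset.range (2 * k), swEx G (c 0) (c j) := by
  apply h.sum_gated hconn (c 0) 0
  · intro t h0 ht
    have := h.dist_sub 0 t h0 (by omega)
    omega
  · intro t h0 ht
    have := h.dist_sub (-t) 0 (by omega) (by omega)
    rw [G.dist_comm] at this
    omega

open Classical in
/-- vertex set of the cycle -/
noncomputable def swC (c : ℤ → V) : Finset V := Finset.univ.filter (fun y => ∃ i, c i = y)

theorem swC_shift (c : ℤ → V) (s : ℤ) : swC (fun i => c (s + i)) = swC c := by
  ext y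
  simp only [swC, mem_filter, mem_univ, true_and]
  constructor
  · rintro ⟨i, hi⟩
    exact ⟨_, hi⟩
  · rintro ⟨i, hi⟩
    exact ⟨i - s, by simpa using hi⟩

theorem SwCyc.per_mod {G : SimpleGraph V} {c : ℤ → V} {k : ℕ} (h : SwCyc G c k) (i : ℤ) :
    c (i % (2 * k)) = c i := by
  have hp : Function.Periodic c (2 * (k : ℤ)) := h.per
  have := hp.int_mul (i / (2 * k)) (i % (2 * k))
  rw [← this]
  congr 1
  exact (Int.emod_add_ediv_mul i (2 * k))

theorem SwCyc.swC_eq {G : SimpleGraph V} {c : ℤ → V} {k : ℕ} (h : SwCyc G c k) :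
    swC c = (Finset.range (2 * k)).image (fun j : ℕ => c j) := by
  have hk := h.two
  ext y
  simp only [swC, mem_filter, mem_univ, true_and, Finset.mem_image, Finset.mem_range]
  constructor
  · rintro ⟨i, rfl⟩
    have h1 := Int.emod_nonneg i (show (2 * (k:ℤ)) ≠ 0 by omega)
    have h2 := Int.emod_lt_of_pos i (show 0 < (2 * (k:ℤ)) by omega)
    refine ⟨(i % (2 * k)).toNat, by omega, ?_⟩
    rw [Int.toNat_of_nonneg h1, h.per_mod]
  · rintro ⟨j, _, rfl⟩
    exact ⟨_, rfl⟩

theorem SwCyc.injOn {G : SimpleGraph V} {c : ℤ → V} {k : ℕ} (h : SwCyc G c k) :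
    Set.InjOn (fun j : ℕ => c j) (Finset.range (2 * k) : Finset ℕ) := by
  intro i hi j hj hij
  simp only [Finset.coe_range, Set.mem_Iio] at hi hj
  rcases lt_trichotomy i j with h1 | h1 | h1
  · exact absurd hij (h.inj i j (by omega) (by omega))
  · exact h1
  · exact absurd hij.symm (h.inj j i (by omega) (by omega))

theorem SwCyc.sum_swC {G : SimpleGraph V} {c : ℤ → V} {k : ℕ} (h : SwCyc G c k) (f : V → ℤ) :
    ∑ y ∈ swC c, f y = ∑ j ∈ Finset.range (2 * k), f (c j) := by
  rw [h.swC_eq, Finset.sum_image h.injOn]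

theorem SwCyc.card_swC {G : SimpleGraph V} {c : ℤ → V} {k : ℕ} (h : SwCyc G c k) :
    (swC c).card = 2 * k := by
  rw [h.swC_eq, Finset.card_image_of_injOn h.injOn, Finset.card_range]

theorem SwCyc.total {G : SimpleGraph V} (hconn : G.Connected) (hbip : G.Colorable 2)
    {c : ℤ → V} {k : ℕ} (h : SwCyc G c k) :
    8 * (Fintype.card V : ℤ) - 16 ≤ ∑ x, ∑ y, swEx G x y := by
  have hk := h.two
  have hin : ∀ x ∈ swC c, (k : ℤ) * (k - 1) + 2 ≤ ∑ y ∈ swC c, swEx G x y := by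
    intro x hx
    simp only [swC, mem_filter, mem_univ, true_and] at hx
    obtain ⟨s, rfl⟩ := hx
    have := (h.shift s).sum_in hconn
    rw [← (h.shift s).sum_swC, swC_shift, add_zero] at this
    exact this
  have hout : ∀ x, 4 ≤ ∑ y ∈ swC c, swEx G x y := by
    intro x
    obtain ⟨y, hy, hmin⟩ := Finset.exists_min_image (swC c) (fun y => G.dist x y)
      ⟨c 0, by simp [swC]⟩
    simp only [swC, mem_filter, mem_univ, true_and] at hy
    obtain ⟨s, rfl⟩ := hy
    have := (h.shift s).sum_out hconn hbip x (by
      intro i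
      rw [add_zero]
      apply hmin
      simp [swC])
    rw [← (h.shift s).sum_swC (fun y => swEx G x y), swC_shift] at this
    exact this
  have hA : ∀ x, ∑ y, swEx G x y = ∑ y ∈ swC c, swEx G x y + ∑ y ∈ (swC c)ᶜ, swEx G x y :=
    fun x => (Finset.sum_add_sum_compl _ _).symm
  have hS : ∑ x, ∑ y, swEx G x y = (∑ x ∈ swC c, ∑ y ∈ swC c, swEx G x y
      + ∑ x ∈ swC c, ∑ y ∈ (swC c)ᶜ, swEx G x y) + (∑ x ∈ (swC c)ᶜ, ∑ y ∈ swC c, swEx G x y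
      + ∑ x ∈ (swC c)ᶜ, ∑ y ∈ (swC c)ᶜ, swEx G x y) := by
    rw [← Finset.sum_add_distrib, ← Finset.sum_add_distrib, ← Finset.sum_add_sum_compl (swC c)]
    simp only [hA]
  have hsw : ∑ x ∈ swC c, ∑ y ∈ (swC c)ᶜ, swEx G x y
      = ∑ x ∈ (swC c)ᶜ, ∑ y ∈ swC c, swEx G x y := by
    rw [Finset.sum_comm]
    exact Finset.sum_congr rfl fun x _ => Finset.sum_congr rfl fun y _ => sw_ex_comm G _ _
  have b1 := Finset.card_nsmul_le_sum _ _ _ hin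
  have b2 := Finset.card_nsmul_le_sum (swC c)ᶜ _ _ (fun x _ => hout x)
  have b3 : 0 ≤ ∑ x ∈ (swC c)ᶜ, ∑ y ∈ (swC c)ᶜ, swEx G x y :=
    Finset.sum_nonneg fun x _ => Finset.sum_nonneg fun y _ => sw_ex_nonneg G hconn _ _
  have hcard := Finset.card_add_card_compl (swC c)
  rw [h.card_swC] at b1 hcard
  rw [hS, hsw]
  have hcc : ((swC c)ᶜ.card : ℤ) = Fintype.card V - 2 * k := by omega
  rw [nsmul_eq_mul] at b1 b2
  rw [hcc] at b2
  push_cast at b1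
  have hk' : (2 : ℤ) ≤ k := by exact_mod_cast hk
  have : 0 ≤ ((k : ℤ) - 2) * (k * k + k - 4) := mul_nonneg (by omega) (by nlinarith)
  nlinarith

/-- geodesic as a function -/
theorem sw_geod (G : SimpleGraph V) (hconn : G.Connected) (r : V) :
    ∀ (n : ℕ) (y : V), G.dist r y = n → ∃ p : ℕ → V, p 0 = r ∧ p n = y ∧
      (∀ i, i < n → G.Adj (p i) (p (i + 1))) ∧ ∀ i, i ≤ n → G.dist r (p i) = i := by
  intro n
  induction n with
  | zero =>
    intro y hy
    have := hconn.dist_eq_zero_iff.mp hy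
    refine ⟨fun _ => r, rfl, this, by simp, ?_⟩
    intro i hi
    simp
    omega
  | succ n ih =>
    intro y hy
    have hne : r ≠ y := by
      rintro rfl
      simp at hy
    obtain ⟨z, hz, hd⟩ := sw_pred G hconn hne
    obtain ⟨p, p0, pn, pa, pd⟩ := ih z (by omega)
    refine ⟨fun i => if i ≤ n then p i else y, by simp [p0], by simp, ?_, ?_⟩
    · intro i hi
      rcases Nat.lt_or_ge i n with h | h
      · simp [h.le, Nat.succ_le_of_lt h]
        exact pa i h
      · obtain rfl : i = n := by omega
        simpa [pn] using hz
    · intro i hi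
      by_cases h : i ≤ n
      · simp [h, pd]
      · simp [h]; omega

/-- `y` has two closer neighbours towards `r`, at distance `k`. -/
def SwBad (G : SimpleGraph V) (k : ℕ) : Prop :=
  ∃ r y u v : V, u ≠ v ∧ G.Adj u y ∧ G.Adj v y ∧ G.dist r y = k ∧ G.dist r u + 1 = k ∧
    G.dist r v + 1 = k

theorem sw_exists_bad (G : SimpleGraph V) [DecidableRel G.Adj]
    (hconn : G.Connected) (hbip : G.Colorable 2)
    (hm : Fintype.card V ≤ G.edgeFinset.card) : ∃ k, SwBad G k := by
  by_contra hno
  obtain ⟨r⟩ := hconn.nonempty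
  have hp : ∀ y, ∃ z, r ≠ y → G.Adj z y ∧ G.dist r y = G.dist r z + 1 := by
    intro y
    by_cases h : r = y
    · exact ⟨r, fun h' => absurd h h'⟩
    · obtain ⟨z, hz⟩ := sw_pred G hconn h
      exact ⟨z, fun _ => hz⟩
  choose f hf using hp
  have main : ∀ a b, G.Adj a b → G.dist r b = G.dist r a + 1 →
      s(a, b) ∈ (Finset.univ.erase r).image (fun y => s(f y, y)) := by
    intro a b hab hd
    have hne : r ≠ b := by
      rintro rfl
      simp at hd
    obtain ⟨h1, h2⟩ := hf b hne
    have : a = f b := by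
      by_contra hne'
      exact hno ⟨_, r, b, a, f b, hne', hab, h1, rfl, hd.symm, h2.symm⟩
    rw [Finset.mem_image]
    exact ⟨b, by simp [hne.symm], by rw [← this]⟩
  have hsub : G.edgeFinset ⊆ (Finset.univ.erase r).image (fun y => s(f y, y)) := by
    intro e he
    induction e using Sym2.ind with
    | _ a b =>
      rw [SimpleGraph.mem_edgeFinset, SimpleGraph.mem_edgeSet] at he
      rcases sw_step G hconn hbip r he with h | h
      · exact main a b he h
      · rw [Sym2.eq_swap]
        exact main b a he.symm h
  have h1 := Finset.card_le_card hsub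
  have h2 := Finset.card_image_le (s := Finset.univ.erase r) (f := fun y => s(f y, y))
  rw [Finset.card_erase_of_mem (Finset.mem_univ r), Finset.card_univ] at h2
  have h3 : 0 < Fintype.card V := Fintype.card_pos_iff.mpr ⟨r⟩
  omega

/-- nonbacktracking closed walk is isometric if no bad pair at smaller distance -/
theorem sw_iso (G : SimpleGraph V) (hconn : G.Connected) (hbip : G.Colorable 2) (c : ℤ → V)
    (k : ℕ) (hmin : ∀ j, j < k → ¬ SwBad G j) (hadj : ∀ i, G.Adj (c i) (c (i + 1)))
    (hnb : ∀ i, c i ≠ c (i + 2)) :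
    ∀ t : ℕ, t ≤ k → ∀ i, G.dist (c i) (c (i + t)) = t := by
  intro t
  induction t using Nat.strong_induction_on with
  | _ t ih =>
    intro ht i
    match t, ih, ht with
    | 0, _, _ => simp
    | 1, _, _ => simpa using hadj i
    | t + 2, ih, ht =>
      have h1 := ih (t + 1) (by omega) (by omega) i
      have h0 := ih t (by omega) (by omega) i
      have a1 := hadj (i + t)
      have a2 := hadj (i + t + 1)
      have n := hnb (i + t)
      push_cast at h1 ⊢
      rw [← add_assoc] at h1 ⊢
      rw [show i + (t:ℤ) + 1 + 1 = i + t + 2 by ring] at a2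
      rcases sw_step G hconn hbip (c i) a2 with h | h
      · omega
      · exact absurd ⟨c i, c (i + t + 1), c (i + t), c (i + t + 2), n, a1, a2.symm, h1,
          by omega, by omega⟩ (hmin (t + 1) (by omega))

theorem sw_exists_cyc (G : SimpleGraph V) [DecidableRel G.Adj]
    (hconn : G.Connected) (hbip : G.Colorable 2)
    (hm : Fintype.card V ≤ G.edgeFinset.card) : ∃ c k, SwCyc G c k := by
  classical
  have hex := sw_exists_bad G hconn hbip hm
  obtain ⟨k, hbad, hmin⟩ : ∃ k, SwBad G k ∧ ∀ j, j < k → ¬ SwBad G j :=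
    ⟨Nat.find hex, Nat.find_spec hex, fun j hj => Nat.find_min hex hj⟩
  obtain ⟨r, y, u, v, huv, hu, hv, hy, hdu, hdv⟩ := hbad
  have hk : 2 ≤ k := by
    by_contra hlt
    have h1 := (hconn.dist_eq_zero_iff (u := r) (v := u)).mp (by omega)
    have h2 := (hconn.dist_eq_zero_iff (u := r) (v := v)).mp (by omega)
    exact huv (h1.symm.trans h2)
  obtain ⟨l, rfl⟩ : ∃ l, k = l + 1 := ⟨k - 1, by omega⟩
  have ext : ∀ u, G.Adj u y → G.dist r u + 1 = l + 1 → ∃ p : ℕ → V, p 0 = r ∧ p l = u ∧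
      p (l + 1) = y ∧ (∀ i, i < l + 1 → G.Adj (p i) (p (i + 1))) ∧
      ∀ i, i ≤ l + 1 → G.dist r (p i) = i := by
    intro u hu hdu
    obtain ⟨p, p0, pn, pa, pd⟩ := sw_geod G hconn r l u (by omega)
    refine ⟨fun i => if i ≤ l then p i else y, by simp [p0], by simp [pn], by simp, ?_, ?_⟩
    · intro i hi
      rcases Nat.lt_or_ge i l with h | h
      · simp [h.le, Nat.succ_le_of_lt h]
        exact pa i h
      · obtain rfl : i = l := by omega
        simpa [pn] using hu
    · intro i hi
      by_cases h : i ≤ l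
      · simp [h, pd]
      · simp [h]; omega
  obtain ⟨p, p0, pl, pk, pa, pd⟩ := ext u hu hdu
  obtain ⟨q, q0, ql, qk, qa, qd⟩ := ext v hv hdv
  have hpq : p 1 ≠ q 1 := by
    intro he
    -- distances from `p 1`
    have dist1 : ∀ p : ℕ → V, (∀ i, i < l + 1 → G.Adj (p i) (p (i + 1))) →
        ∀ i, i + 1 ≤ l + 1 → G.dist (p 1) (p (i + 1)) ≤ i := by
      intro p pa i
      induction i with
      | zero => simp
      | succ i ih =>
        intro hi
        have h1 := hconn.dist_triangle (u := p 1) (v := p (i + 1)) (w := p (i + 1 + 1))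
        rw [SimpleGraph.dist_eq_one_iff_adj.mpr (pa (i + 1) (by omega))] at h1
        have := ih (by omega)
        omega
    obtain ⟨m, rfl⟩ : ∃ m, l = m + 1 := ⟨l - 1, by omega⟩
    have e1 := dist1 p pa m (by omega)
    have e2 := dist1 q qa m (by omega)
    rw [pl] at e1
    rw [ql, ← he] at e2
    have d1 := pd 1 (by omega)
    have t1 := hconn.dist_triangle (u := r) (v := p 1) (w := y)
    have t2 := hconn.dist_triangle (u := p 1) (v := u) (w := y)
    have t3 := hconn.dist_triangle (u := p 1) (v := v) (w := y)
    rw [SimpleGraph.dist_eq_one_iff_adj.mpr hu] at t2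
    rw [SimpleGraph.dist_eq_one_iff_adj.mpr hv] at t3
    exact hmin (m + 1) (by omega) ⟨p 1, y, u, v, huv, hu, hv, by omega, by omega, by omega⟩
  -- the closed walk on one period
  let w : ℤ → V := fun j => if j ≤ l + 1 then p j.toNat else q (2 * (l + 1) - j).toNat
  have wp : ∀ j : ℕ, j ≤ l + 1 → w j = p j := by
    intro j hj
    simp only [w]
    rw [if_pos (by omega)]
    simp
  have wq : ∀ j : ℕ, j ≤ l + 1 → w (2 * (l + 1) - j) = q j := by
    intro j hj
    simp only [w]
    split_ifs with h
    · obtain rfl : j = l + 1 := by omega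
      rw [qk, ← pk]
      congr 1
      omega
    · congr 1
      omega
  let c : ℤ → V := fun i => w (i % (2 * (l + 1)))
  have hc : ∀ i j n : ℤ, 0 ≤ j → j ≤ 2 * (l + 1) → i = j + 2 * (l + 1) * n → c i = w j := by
    intro i j n h0 h1 h2
    simp only [c]
    rw [h2, Int.add_mul_emod_self_left]
    rcases eq_or_lt_of_le h1 with h3 | h3
    · subst h3
      rw [Int.emod_self]
      have a1 := wp 0 (by omega)
      have a2 := wq 0 (by omega)
      push_cast at a1 a2
      rw [sub_zero] at a2
      rw [a1, a2, p0, q0]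
    · rw [Int.emod_eq_of_lt h0 h3]
  have hmod : ∀ i : ℤ, ∃ j n : ℤ, 0 ≤ j ∧ j < 2 * (l + 1) ∧ i = j + 2 * (l + 1) * n := fun i =>
    ⟨i % (2 * (l + 1)), i / (2 * (l + 1)), Int.emod_nonneg _ (by omega),
      Int.emod_lt_of_pos _ (by omega), (Int.emod_add_mul_ediv _ _).symm⟩
  have hadj : ∀ i, G.Adj (c i) (c (i + 1)) := by
    intro i
    obtain ⟨j, n, h0, h1, h2⟩ := hmod i
    rw [hc i j n h0 h1.le h2, hc (i + 1) (j + 1) n (by omega) (by omega) (by rw [h2]; ring)]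
    rcases lt_or_ge j (l + 1) with h | h
    · lift j to ℕ using h0
      have b := wp (j + 1) (by omega)
      push_cast at b
      rw [wp j (by omega), b]
      exact pa j (by omega)
    · obtain ⟨s, hs⟩ : ∃ s : ℕ, j = 2 * (l + 1) - (s + 1) := ⟨(2 * (l + 1) - j - 1).toNat, by omega⟩
      have a := wq (s + 1) (by omega)
      have b := wq s (by omega)
      push_cast at a
      rw [hs, a, show 2 * ((l:ℤ) + 1) - (s + 1) + 1 = 2 * (l + 1) - s by ring, b]
      exact (qa s (by omega)).symm
  have hnb : ∀ i, c i ≠ c (i + 2) := by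
    intro i
    obtain ⟨j, n, h0, h1, h2⟩ := hmod i
    rw [hc i j n h0 h1.le h2]
    rcases eq_or_ne j (2 * (l + 1) - 1) with h | h
    · rw [hc (i + 2) 1 (n + 1) (by omega) (by omega) (by rw [h2, h]; ring), h]
      have a := wp 1 (by omega)
      have b := wq 1 (by omega)
      push_cast at a b
      rw [a, b]
      exact hpq.symm
    · rw [hc (i + 2) (j + 2) n (by omega) (by omega) (by rw [h2]; ring)]
      rcases lt_trichotomy j l with h | h | h
      · lift j to ℕ using h0
        have b := wp (j + 2) (by omega)
        push_cast at b
        rw [wp j (by omega), b]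
        intro he
        have e1 := pd j (by omega)
        have e2 := pd (j + 2) (by omega)
        rw [he] at e1
        omega
      · have b := wq l (by omega)
        rw [h, wp l (by omega), show (l:ℤ) + 2 = 2 * (l + 1) - l by ring, b, pl, ql]
        exact huv
      · obtain ⟨s, hs⟩ : ∃ s : ℕ, j = 2 * (l + 1) - (s + 2) :=
          ⟨(2 * (l + 1) - j - 2).toNat, by omega⟩
        have a := wq (s + 2) (by omega)
        have b := wq s (by omega)
        push_cast at a
        rw [hs, a, show 2 * ((l:ℤ) + 1) - (s + 2) + 2 = 2 * (l + 1) - s by ring, b]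
        intro he
        have e1 := qd s (by omega)
        have e2 := qd (s + 2) (by omega)
        rw [he] at e2
        omega
  refine ⟨c, l + 1, hk, hadj, ?_, sw_iso G hconn hbip c (l + 1) hmin hadj hnb⟩
  intro i
  simp only [c]
  push_cast
  rw [Int.add_emod_right]

theorem sw_sum_sym2 (g : Sym2 V → ℚ) (hg : ∀ x, g s(x, x) = 0) :
    ∑ x, ∑ y, g s(x, y) = 2 * ∑ e ∈ (Finset.univ : Finset V).sym2, g e := by
  rw [← Fintype.sum_prod_type' (f := fun x y => g s(x, y)), Finset.mul_sum]
  rw [← Finset.sum_fiberwise_of_maps_to (s := Finset.univ) (t := (Finset.univ : Finset V).sym2)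
    (g := fun p : V × V => s(p.1, p.2)) (by simp)]
  apply Finset.sum_congr rfl
  intro e _
  induction e using Sym2.ind with
  | _ a b =>
    by_cases hab : a = b
    · subst hab
      rw [hg, mul_zero]
      apply Finset.sum_eq_zero
      intro p hp
      rw [(Finset.mem_filter.mp hp).2, hg]
    · have : (Finset.univ.filter (fun p : V × V => s(p.1, p.2) = s(a, b))) =
          {(a, b), (b, a)} := by
        ext ⟨x, y⟩
        simp
      rw [this, Finset.sum_pair (by simp [hab]), Sym2.eq_swap (a := b), two_mul]

theorem sw_wiener (G : SimpleGraph V) :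
    2 * (wiener G : ℚ) = ∑ x, ∑ y, (G.dist x y : ℚ) := by
  unfold wiener
  rw [Nat.cast_sum, ← sw_sum_sym2]
  · simp
  · simp

theorem sw_comm4 (f : V → V → V → V → ℚ) :
    ∑ x, ∑ y, ∑ u, ∑ v, f x y u v = ∑ u, ∑ v, ∑ x, ∑ y, f x y u v := by
  have := Finset.sum_comm (s := Finset.univ) (t := Finset.univ)
    (f := fun p q : V × V => f p.1 p.2 q.1 q.2)
  simpa only [Fintype.sum_prod_type] using this

theorem sw_szeged (G : SimpleGraph V) [DecidableRel G.Adj] :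
    ∑ x, ∑ y, ((swSep G x y).card : ℚ) = 2 * (szeged G : ℚ) := by
  classical
  have h1 : (szeged G : ℚ) = ∑ e ∈ (Finset.univ : Finset V).sym2,
      if e ∈ G.edgeSet then (edgeContribution G e : ℚ) else 0 := by
    unfold szeged
    rw [Nat.cast_sum, ← Finset.sum_filter]
    apply Finset.sum_congr _ (fun _ _ => rfl)
    ext e
    simp
  rw [h1, ← sw_sum_sym2 _ (by simp)]
  have h2 : ∀ u v, (if s(u, v) ∈ G.edgeSet then (edgeContribution G s(u, v) : ℚ) else 0) =
      ∑ x, ∑ y, if G.Adj u v ∧ G.dist x u < G.dist x v ∧ G.dist y v < G.dist y u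
        then (1 : ℚ) else 0 := by
    intro u v
    simp only [SimpleGraph.mem_edgeSet]
    split_ifs with h
    · simp only [edgeContribution, Sym2.lift_mk, nCloser, Finset.card_filter]
      push_cast
      rw [Finset.sum_mul_sum]
      refine Finset.sum_congr rfl fun x _ => Finset.sum_congr rfl fun y _ => ?_
      rw [G.dist_comm (u := u) (v := x), G.dist_comm (u := v) (v := x),
        G.dist_comm (u := u) (v := y), G.dist_comm (u := v) (v := y)]
      by_cases h1 : G.dist x u < G.dist x v <;> by_cases h2 : G.dist y v < G.dist y u <;>
        simp [h, h1, h2]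
    · simp [h]
  simp_rw [h2]
  have h3 : ∀ x y, ((swSep G x y).card : ℚ) = ∑ u, ∑ v,
      if G.Adj u v ∧ G.dist x u < G.dist x v ∧ G.dist y v < G.dist y u
        then (1 : ℚ) else 0 := by
    intro x y
    rw [← Fintype.sum_prod_type' (f := fun u v =>
      if G.Adj u v ∧ G.dist x u < G.dist x v ∧ G.dist y v < G.dist y u then (1 : ℚ) else 0)]
    simp only [swSep, Finset.card_filter]
    push_cast
    refine Finset.sum_congr rfl fun p _ => ?_
    congr
  simp_rw [h3]
  exact sw_comm4 _

theorem sw_star_ge (G : SimpleGraph V) [DecidableRel G.Adj] : (szeged G : ℚ) ≤ szegedStar G := by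
  unfold szeged szegedStar
  rw [Nat.cast_sum]
  apply Finset.sum_le_sum
  intro e _
  induction e using Sym2.ind with
  | _ a b =>
    simp only [edgeContribution, Sym2.lift_mk]
    push_cast
    gcongr <;> simp <;> positivity

end helpers

theorem szegedStar_sub_wiener_bipartite (G : SimpleGraph V) [DecidableRel G.Adj]
    (hconn : G.Connected) (hbip : G.Colorable 2)
    (hn : 4 ≤ Fintype.card V) (hm : Fintype.card V ≤ G.edgeFinset.card) :
    4 * (Fintype.card V : ℚ) - 8 ≤ szegedStar G - (wiener G : ℚ) := by
  obtain ⟨c, k, h⟩ := sw_exists_cyc G hconn hbip hm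
  have h1 := h.total hconn hbip
  have h2 := sw_szeged G
  have h3 := sw_wiener G
  have h4 := sw_star_ge G
  have h5 : ((∑ x, ∑ y, swEx G x y : ℤ) : ℚ) = 2 * (szeged G : ℚ) - 2 * (wiener G : ℚ) := by
    rw [← h2, h3, ← Finset.sum_sub_distrib]
    simp_rw [← Finset.sum_sub_distrib]
    push_cast [swEx]
    rfl
  have h6 : (8 * (Fintype.card V : ℚ) - 16) ≤ ((∑ x, ∑ y, swEx G x y : ℤ) : ℚ) := by
    exact_mod_cast h1
  linarith
end
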